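/- Fix z = E + iη with η > 0 and an integer d ≥ 3. There exists a constant C(d) > 0 such that for every real s ≥ 1, every u > 0 and every admissible N, setting F̃_s = (1/N)·∑_{j=1}^N (Im G_N(z)_{jj})^s, one has P( |F̃_s − E[F̃_s]| ≥ u ) ≤ 2·exp(−N·η^{2s+2}·u²/(8s²)) + 2·exp(−N·η^{2s+2}·u²/(C·t²·s²)). -/

import Mathlib

open MeasureTheory ProbabilityTheory Matrix Filter
open scoped ENNReal NNReal Classical Real

noncomputable section

/-- `a` is the Boolean adjacency matrix of a simple `d`-regular graph on `Fin N`: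
symmetric, zero diagonal, every row sum equal to `d`. -/
def IsRegAdj (d N : ℕ) (a : Fin N → Fin N → Bool) : Prop :=
  (∀ i j, a i j = a j i) ∧ (∀ i, a i i = false) ∧
    (∀ i, (Finset.univ.filter (fun j => a i j = true)).card = d)

/-- The tight-binding Hamiltonian `W_N = -t A_N + diag(v)`. -/
def Wmat (t : ℝ) {N : ℕ} (a : Fin N → Fin N → Bool) (v : Fin N → ℝ) :
    Matrix (Fin N) (Fin N) ℝ :=
  fun i j => (if a i j then -t else 0) + (if i = j then v i else 0)

/-- The resMat `G(z) = (W - z)⁻¹` as a complex matrix. -/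
def resMat {N : ℕ} (z : ℂ) (W : Matrix (Fin N) (Fin N) ℝ) :
    Matrix (Fin N) (Fin N) ℂ :=
  (W.map (fun x => (x : ℂ)) - z • 1)⁻¹

/-- The law of `(A_N, (g_1,…,g_N))`: a uniformly random simple `d`-regular graph on `N`
vertices together with independent i.i.d. standard Gaussian potentials. -/
def graphMeasure (d N : ℕ) : Measure ((Fin N → Fin N → Bool) × (Fin N → ℝ)) :=
  (uniformOn {a | IsRegAdj d N a}).prod (Measure.pi fun _ => gaussianReal 0 1)

/-- `Im G_N(z)_{jj}` for the sample `ω = (A_N, v)`. -/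
def imG (t : ℝ) (z : ℂ) {N : ℕ} (ω : (Fin N → Fin N → Bool) × (Fin N → ℝ))
    (j : Fin N) : ℝ :=
  (resMat z (Wmat t ω.1 ω.2) j j).im

/-- `F̃_s(z) = (1/N) ∑_j (Im G_N(z)_{jj})^s`. -/
def Ftil (t : ℝ) (s : ℝ) (z : ℂ) {N : ℕ}
    (ω : (Fin N → Fin N → Bool) × (Fin N → ℝ)) : ℝ :=
  (1 / (N : ℝ)) * ∑ j, imG t z ω j ^ s

/-! ### Resolvent estimates -/

lemma res_isUnit {N : ℕ} {z : ℂ} (hz : 0 < z.im) {W : Matrix (Fin N) (Fin N) ℝ}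
    (hW : Wᵀ = W) : IsUnit (W.map (fun x => (x : ℂ)) - z • 1).det := by
  rw [isUnit_iff_ne_zero]
  intro h0
  obtain ⟨x, hx, hx0⟩ := Matrix.exists_mulVec_eq_zero_iff.mpr h0
  have hH : (W.map (fun x => (x : ℂ))).IsHermitian := by
    ext i j
    have := congrFun (congrFun hW i) j
    simp only [Matrix.transpose_apply] at this
    simp [this]
  have h1 : (W.map (fun x => (x : ℂ))) *ᵥ x = z • x := by
    rw [Matrix.sub_mulVec, Matrix.smul_mulVec, Matrix.one_mulVec, sub_eq_zero] at hx0
    exact hx0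
  have h2 := hH.im_star_dotProduct_mulVec_self x
  rw [h1, dotProduct_smul] at h2
  have h3 : (star x ⬝ᵥ x) = ((∑ i, ‖x i‖ ^ 2 : ℝ) : ℂ) := by
    simp only [dotProduct, Pi.star_apply, RCLike.star_def, Complex.ofReal_sum]
    refine Finset.sum_congr rfl fun i _ => ?_
    rw [Complex.conj_mul']
    simp
  rw [h3] at h2
  have h4 : z.im * (∑ i, ‖x i‖ ^ 2) = 0 := by
    clear h3
    revert h2
    generalize (∑ i, ‖x i‖ ^ 2) = S
    intro h2
    simpa using h2
  have h5 : (∑ i, ‖x i‖ ^ 2) = 0 := by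
    rcases mul_eq_zero.mp h4 with h | h
    · exact absurd h hz.ne'
    · exact h
  apply hx
  ext i
  have := (Finset.sum_eq_zero_iff_of_nonneg (fun i _ => by positivity)).mp h5 i (Finset.mem_univ i)
  simpa using this

lemma res_symm {N : ℕ} {z : ℂ} {W : Matrix (Fin N) (Fin N) ℝ}
    (hW : Wᵀ = W) (i j : Fin N) : resMat z W i j = resMat z W j i := by
  have h : (resMat z W)ᵀ = resMat z W := by
    unfold resMat
    rw [Matrix.transpose_nonsing_inv]
    congr 1
    rw [Matrix.transpose_sub, Matrix.transpose_smul, Matrix.transpose_one]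
    congr 1
    ext i j
    have := congrFun (congrFun hW i) j
    simp only [Matrix.transpose_apply] at this
    simp [this]
  exact congrFun (congrFun h j) i

lemma res_im {N : ℕ} {z : ℂ} (hz : 0 < z.im) {W : Matrix (Fin N) (Fin N) ℝ}
    (hW : Wᵀ = W) (j : Fin N) :
    (resMat z W j j).im = z.im * ∑ k, ‖resMat z W j k‖ ^ 2 := by
  have hu := res_isUnit hz hW
  set A := W.map (fun x => (x : ℂ)) - z • 1 with hA
  have hG : resMat z W = A⁻¹ := rfl
  have hAH : Aᴴ - A = (2 * Complex.I * z.im) • (1 : Matrix (Fin N) (Fin N) ℂ) := by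
    ext i j
    have h1 := congrFun (congrFun hW i) j
    simp only [Matrix.transpose_apply] at h1
    by_cases hij : i = j
    · subst hij
      simp [hA, Complex.ext_iff]
      ring
    · simp [hA, h1, hij]
  have h1 : A⁻¹ - (A⁻¹)ᴴ = (2 * Complex.I * z.im) • (A⁻¹ * (A⁻¹)ᴴ) := by
    have : A⁻¹ * (Aᴴ - A) * (A⁻¹)ᴴ = A⁻¹ - (A⁻¹)ᴴ := by
      rw [Matrix.mul_sub, Matrix.sub_mul, Matrix.nonsing_inv_mul _ hu, Matrix.one_mul,
        Matrix.mul_assoc, ← Matrix.conjTranspose_mul, Matrix.nonsing_inv_mul _ hu]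
      simp
    rw [← this, hAH]
    simp
  have h2 := congrFun (congrFun h1 j) j
  simp only [Matrix.sub_apply, Matrix.conjTranspose_apply, Matrix.smul_apply, Matrix.mul_apply,
    smul_eq_mul] at h2
  rw [hG]
  have h3 : ∑ x, A⁻¹ j x * star (A⁻¹ j x) = ((∑ k, ‖A⁻¹ j k‖ ^ 2 : ℝ) : ℂ) := by
    rw [Complex.ofReal_sum]
    refine Finset.sum_congr rfl fun i _ => ?_
    rw [RCLike.star_def, Complex.mul_conj']
    simp
  rw [h3] at h2
  clear h3
  revert h2
  generalize (∑ k, ‖A⁻¹ j k‖ ^ 2) = S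
  intro h2
  have h4 := congrArg Complex.im h2
  simp at h4
  linarith

lemma res_row {N : ℕ} {z : ℂ} (hz : 0 < z.im) {W : Matrix (Fin N) (Fin N) ℝ}
    (hW : Wᵀ = W) (j : Fin N) : ∑ k, ‖resMat z W j k‖ ^ 2 ≤ (1 / z.im) ^ 2 := by
  have h := res_im hz hW j
  set S := ∑ k, ‖resMat z W j k‖ ^ 2 with hS
  have hS0 : 0 ≤ S := Finset.sum_nonneg fun i _ => by positivity
  have h1 : ‖resMat z W j j‖ ^ 2 ≤ S :=
    Finset.single_le_sum (f := fun k => ‖resMat z W j k‖ ^ 2) (fun i _ => by positivity)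
      (Finset.mem_univ j)
  have h2 : (resMat z W j j).im ≤ ‖resMat z W j j‖ := (le_abs_self _).trans (Complex.abs_im_le_norm _)
  have h3 : (z.im * S) ^ 2 ≤ S := by
    rw [← h]
    have h0 : 0 ≤ (resMat z W j j).im := by rw [h]; exact mul_nonneg hz.le hS0
    exact (pow_le_pow_left₀ h0 h2 2).trans h1
  rcases hS0.eq_or_lt with h0 | h0
  · rw [← h0]; positivity
  · rw [div_pow, one_pow, le_div_iff₀ (by positivity)]
    have : (S * z.im ^ 2) * S ≤ 1 * S := by
      calc _ = (z.im * S) ^ 2 := by ring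
        _ ≤ _ := by rw [one_mul]; exact h3
    exact le_of_mul_le_mul_right this h0

lemma res_im_nonneg {N : ℕ} {z : ℂ} (hz : 0 < z.im) {W : Matrix (Fin N) (Fin N) ℝ}
    (hW : Wᵀ = W) (j : Fin N) : 0 ≤ (resMat z W j j).im := by
  rw [res_im hz hW]
  have : 0 ≤ ∑ k, ‖resMat z W j k‖ ^ 2 := Finset.sum_nonneg fun i _ => by positivity
  positivity

lemma res_im_le {N : ℕ} {z : ℂ} (hz : 0 < z.im) {W : Matrix (Fin N) (Fin N) ℝ}
    (hW : Wᵀ = W) (j : Fin N) : (resMat z W j j).im ≤ 1 / z.im := by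
  rw [res_im hz hW]
  have := res_row hz hW j
  calc z.im * ∑ k, ‖resMat z W j k‖ ^ 2 ≤ z.im * (1 / z.im) ^ 2 := by gcongr
    _ = 1 / z.im := by field_simp

lemma res_cs {N : ℕ} {z : ℂ} (hz : 0 < z.im) {W W' : Matrix (Fin N) (Fin N) ℝ}
    (hW : Wᵀ = W) (hW' : W'ᵀ = W') (k l : Fin N) :
    ∑ j, ‖resMat z W j k‖ * ‖resMat z W' l j‖ ≤ (1 / z.im) ^ 2 := by
  have h1 := res_row hz hW k
  have h2 := res_row hz hW' l
  have h3 : ∀ j, ‖resMat z W j k‖ * ‖resMat z W' l j‖ ≤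
      (‖resMat z W k j‖ ^ 2 + ‖resMat z W' l j‖ ^ 2) / 2 := by
    intro j
    rw [res_symm hW j k]
    nlinarith [sq_nonneg (‖resMat z W k j‖ - ‖resMat z W' l j‖)]
  calc _ ≤ ∑ j, (‖resMat z W k j‖ ^ 2 + ‖resMat z W' l j‖ ^ 2) / 2 :=
        Finset.sum_le_sum fun j _ => h3 j
    _ = ((∑ j, ‖resMat z W k j‖ ^ 2) + ∑ j, ‖resMat z W' l j‖ ^ 2) / 2 := by
        rw [← Finset.sum_div, Finset.sum_add_distrib]
    _ ≤ _ := by linarith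

lemma res_diff {N : ℕ} {z : ℂ} (hz : 0 < z.im) {W W' : Matrix (Fin N) (Fin N) ℝ}
    (hW : Wᵀ = W) (hW' : W'ᵀ = W') (j : Fin N) :
    ‖resMat z W j j - resMat z W' j j‖ ≤
      ∑ k, ∑ l, |W k l - W' k l| * (‖resMat z W j k‖ * ‖resMat z W' l j‖) := by
  have hu := res_isUnit hz hW
  have hu' := res_isUnit hz hW'
  have h1 : resMat z W - resMat z W' =
      resMat z W * ((W' - W).map (fun x => (x : ℂ))) * resMat z W' := by
    have h2 : (W' - W).map (fun x => (x : ℂ)) =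
      (W'.map (fun x => (x : ℂ)) - z • 1) - (W.map (fun x => (x : ℂ)) - z • 1) := by
      ext i j; simp
    rw [h2]
    unfold resMat
    rw [Matrix.mul_sub, Matrix.sub_mul, Matrix.nonsing_inv_mul _ hu, Matrix.one_mul,
      Matrix.mul_assoc, Matrix.mul_nonsing_inv _ hu', Matrix.mul_one]
  have h2 := congrFun (congrFun h1 j) j
  rw [Matrix.sub_apply] at h2
  rw [h2, Matrix.mul_apply]
  simp only [Matrix.mul_apply, Finset.sum_mul]
  rw [Finset.sum_comm]
  refine (norm_sum_le _ _).trans (Finset.sum_le_sum fun k _ => ?_)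
  refine (norm_sum_le _ _).trans (Finset.sum_le_sum fun l _ => ?_)
  rw [norm_mul, norm_mul, Matrix.map_apply, Complex.norm_real, Real.norm_eq_abs, Matrix.sub_apply,
    abs_sub_comm]
  apply le_of_eq; ring

lemma rpow_lip {s b x y : ℝ} (hs : 1 ≤ s) (hx : 0 ≤ x) (hy : 0 ≤ y) (hxb : x ≤ b) (hyb : y ≤ b) :
    |x ^ s - y ^ s| ≤ s * b ^ (s - 1) * |x - y| := by
  have := Convex.norm_image_sub_le_of_norm_hasDerivWithin_le (f := fun x : ℝ => x ^ s)
    (f' := fun x => s * x ^ (s - 1)) (s := Set.Icc 0 b) (C := s * b ^ (s - 1)) (x := y) (y := x)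
    (fun w hw => (Real.hasDerivAt_rpow_const (Or.inr hs)).hasDerivWithinAt) (fun w hw => by
      rw [Real.norm_eq_abs, abs_of_nonneg (by have := Real.rpow_nonneg hw.1 (s-1); positivity)]
      have := Real.rpow_le_rpow hw.1 hw.2 (by linarith : 0 ≤ s - 1)
      gcongr) (convex_Icc _ _) ⟨hy, hyb⟩ ⟨hx, hxb⟩
  simpa [Real.norm_eq_abs] using this

/-- The normalized moment functional of the resolvent diagonal. -/
def Fm (s : ℝ) (z : ℂ) {N : ℕ} (W : Matrix (Fin N) (Fin N) ℝ) : ℝ :=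
  (1 / (N : ℝ)) * ∑ j, (resMat z W j j).im ^ s

lemma Fm_lip {N : ℕ} {s : ℝ} (hs : 1 ≤ s) {z : ℂ} (hz : 0 < z.im)
    {W W' : Matrix (Fin N) (Fin N) ℝ} (hW : Wᵀ = W) (hW' : W'ᵀ = W') :
    |Fm s z W - Fm s z W'| ≤
      (s * (1 / z.im) ^ (s + 1) / N) * ∑ k, ∑ l, |W k l - W' k l| := by
  have hb : (0:ℝ) < 1 / z.im := by positivity
  have h1 : Fm s z W - Fm s z W' =
      (1 / (N : ℝ)) * ∑ j, ((resMat z W j j).im ^ s - (resMat z W' j j).im ^ s) := by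
    unfold Fm; rw [Finset.sum_sub_distrib]; ring
  rw [h1, abs_mul, abs_of_nonneg (by positivity : (0:ℝ) ≤ 1 / (N:ℝ))]
  have h2 : |∑ j, ((resMat z W j j).im ^ s - (resMat z W' j j).im ^ s)| ≤
      s * (1 / z.im) ^ (s - 1) * ((1 / z.im) ^ 2 * ∑ k, ∑ l, |W k l - W' k l|) := by
    calc _ ≤ ∑ j, |((resMat z W j j).im ^ s - (resMat z W' j j).im ^ s)| :=
          Finset.abs_sum_le_sum_abs _ _
      _ ≤ ∑ j, s * (1 / z.im) ^ (s - 1) *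
            ∑ k, ∑ l, |W k l - W' k l| * (‖resMat z W j k‖ * ‖resMat z W' l j‖) := by
          refine Finset.sum_le_sum fun j _ => ?_
          refine (rpow_lip hs (res_im_nonneg hz hW j) (res_im_nonneg hz hW' j)
            (res_im_le hz hW j) (res_im_le hz hW' j)).trans ?_
          have h3 := res_diff hz hW hW' j
          have h4 := Complex.abs_im_le_norm (resMat z W j j - resMat z W' j j)
          rw [Complex.sub_im] at h4
          have h5 := h4.trans h3
          gcongr
      _ = s * (1 / z.im) ^ (s - 1) * ∑ k, ∑ l, |W k l - W' k l| *
            ∑ j, (‖resMat z W j k‖ * ‖resMat z W' l j‖) := by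
          rw [← Finset.mul_sum, Finset.sum_comm]
          congr 1
          refine Finset.sum_congr rfl fun k _ => ?_
          rw [Finset.sum_comm]
          refine Finset.sum_congr rfl fun l _ => ?_
          rw [Finset.mul_sum]
      _ ≤ s * (1 / z.im) ^ (s - 1) * ∑ k, ∑ l, |W k l - W' k l| * (1 / z.im) ^ 2 := by
          gcongr with k _ l _
          exact res_cs hz hW hW' k l
      _ = _ := by
          simp only [← Finset.sum_mul]
          ring
  have h6 : (1 / z.im) ^ (s + 1) = (1 / z.im) ^ (s - 1) * (1 / z.im) ^ 2 := by
    rw [← Real.rpow_natCast (1 / z.im) 2, ← Real.rpow_add hb]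
    congr 1; push_cast; ring
  calc _ ≤ (1 / (N:ℝ)) * (s * (1 / z.im) ^ (s - 1) * ((1 / z.im) ^ 2 *
        ∑ k, ∑ l, |W k l - W' k l|)) := by gcongr
    _ = _ := by rw [h6]; ring

lemma Fm_abs_le {N : ℕ} {s : ℝ} (hs : 1 ≤ s) {z : ℂ} (hz : 0 < z.im)
    {W : Matrix (Fin N) (Fin N) ℝ} (hW : Wᵀ = W) :
    |Fm s z W| ≤ (1 / (N:ℝ)) * (N * (1 / z.im) ^ s) := by
  unfold Fm
  have h0 : 0 ≤ ∑ j, (resMat z W j j).im ^ s :=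
    Finset.sum_nonneg fun j _ => Real.rpow_nonneg (res_im_nonneg hz hW j) _
  rw [abs_mul, abs_of_nonneg h0, abs_of_nonneg (by positivity : (0:ℝ) ≤ 1 / (N:ℝ))]
  gcongr
  calc _ ≤ ∑ j : Fin N, (1 / z.im) ^ s := Finset.sum_le_sum fun j _ =>
        Real.rpow_le_rpow (res_im_nonneg hz hW j) (res_im_le hz hW j) (by linarith)
    _ = _ := by simp

/-- The Hamiltonian attached to a general real matrix. -/
def Wgen (t : ℝ) {N : ℕ} (M : Matrix (Fin N) (Fin N) ℝ) (v : Fin N → ℝ) :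
    Matrix (Fin N) (Fin N) ℝ :=
  fun i j => -t * M i j + (if i = j then v i else 0)

lemma Wgen_symm (t : ℝ) {N : ℕ} {M : Matrix (Fin N) (Fin N) ℝ} (hM : Mᵀ = M) (v : Fin N → ℝ) :
    (Wgen t M v)ᵀ = Wgen t M v := by
  ext i j
  have h1 := congrFun (congrFun hM i) j
  simp only [Matrix.transpose_apply] at h1
  simp only [Wgen, Matrix.transpose_apply, h1]
  by_cases hij : i = j
  · simp [hij]
  · have hji : ¬ j = i := fun h => hij h.symm
    simp [hij, hji]

lemma Fm_lip_M {N : ℕ} {s : ℝ} (hs : 1 ≤ s) {z : ℂ} (hz : 0 < z.im) {t : ℝ} (ht : 0 < t)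
    {M M' : Matrix (Fin N) (Fin N) ℝ} (hM : Mᵀ = M) (hM' : M'ᵀ = M') (v : Fin N → ℝ) :
    |Fm s z (Wgen t M v) - Fm s z (Wgen t M' v)| ≤
      (s * (1 / z.im) ^ (s + 1) / N) * (t * ∑ k, ∑ l, |M k l - M' k l|) := by
  refine (Fm_lip hs hz (Wgen_symm t hM v) (Wgen_symm t hM' v)).trans (le_of_eq ?_)
  congr 1
  simp only [Finset.mul_sum]
  refine Finset.sum_congr rfl fun k _ => Finset.sum_congr rfl fun l _ => ?_
  simp only [Wgen]
  rw [← abs_of_pos ht, ← abs_mul, abs_of_pos ht, ← abs_neg]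
  congr 1; ring

lemma Fm_lip_v {N : ℕ} {s : ℝ} (hs : 1 ≤ s) {z : ℂ} (hz : 0 < z.im) (t : ℝ)
    {M : Matrix (Fin N) (Fin N) ℝ} (hM : Mᵀ = M) (v v' : Fin N → ℝ) :
    |Fm s z (Wgen t M v) - Fm s z (Wgen t M v')| ≤
      (s * (1 / z.im) ^ (s + 1) / N) * ∑ k, |v k - v' k| := by
  refine (Fm_lip hs hz (Wgen_symm t hM v) (Wgen_symm t hM v')).trans (le_of_eq ?_)
  congr 1
  refine Finset.sum_congr rfl fun k _ => ?_
  rw [Finset.sum_eq_single k]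
  · simp [Wgen]
  · intro l _ hl
    simp [Wgen, hl.symm]
  · simp

/-! ### Gaussian concentration -/

lemma integrable_of_abs_le {Ω : Type*} [MeasurableSpace Ω] {μ : Measure Ω} [IsFiniteMeasure μ]
    {f : Ω → ℝ} (hf : Measurable f) {B : ℝ} (hB : ∀ x, |f x| ≤ B) : Integrable f μ :=
  Integrable.of_bound hf.aestronglyMeasurable B (Eventually.of_forall hB)

lemma integrable_exp_of_abs_le {Ω : Type*} [MeasurableSpace Ω] {μ : Measure Ω} [IsFiniteMeasure μ]
    {f : Ω → ℝ} (hf : Measurable f) {B : ℝ} (hB : ∀ x, |f x| ≤ B) :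
    Integrable (fun x => Real.exp (f x)) μ :=
  integrable_of_abs_le (B := Real.exp B) (Real.measurable_exp.comp hf) (fun x => by
    rw [abs_of_pos (Real.exp_pos _)]
    exact Real.exp_le_exp.mpr ((le_abs_self _).trans (hB x)))

lemma abs_integral_le_of_abs_le {Ω : Type*} [MeasurableSpace Ω] {μ : Measure Ω}
    [IsProbabilityMeasure μ] {f : Ω → ℝ} {B : ℝ} (hB : ∀ x, |f x| ≤ B) : |∫ x, f x ∂μ| ≤ B := by
  have := norm_integral_le_of_norm_le_const (μ := μ) (f := f) (C := B) (Eventually.of_forall hB)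
  simpa using this

lemma jensen_symm {Ω : Type*} [MeasurableSpace Ω] {μ : Measure Ω} [IsProbabilityMeasure μ]
    {g : Ω → ℝ} (hg : Measurable g) {B : ℝ} (hB : ∀ x, |g x| ≤ B) (l : ℝ) :
    ∫ x, Real.exp (l * (g x - ∫ y, g y ∂μ)) ∂μ ≤
      ∫ p, Real.exp (l * (g p.1 - g p.2)) ∂(μ.prod μ) := by
  have hB2 : ∀ x y, |l * (g x - g y)| ≤ |l| * (B + B) := by
    intro x y
    rw [abs_mul]
    gcongr
    exact (abs_sub _ _).trans (add_le_add (hB x) (hB y))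
  have hInt : Integrable (fun p : Ω × Ω => Real.exp (l * (g p.1 - g p.2))) (μ.prod μ) :=
    integrable_exp_of_abs_le (by fun_prop) (fun p => hB2 p.1 p.2)
  rw [integral_prod _ hInt]
  have hm := abs_integral_le_of_abs_le (μ := μ) hB
  refine integral_mono ?_ hInt.integral_prod_left ?_
  · refine integrable_exp_of_abs_le (B := |l| * (B + B)) (by fun_prop) (fun x => ?_)
    rw [abs_mul]
    gcongr
    exact (abs_sub _ _).trans (add_le_add (hB x) hm)
  · intro x
    have h1 : l * (g x - ∫ y, g y ∂μ) = ∫ y, l * (g x - g y) ∂μ := by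
      rw [integral_const_mul, integral_sub (integrable_const _) (integrable_of_abs_le hg hB)]
      simp
    simp only
    rw [h1]
    exact convexOn_exp.map_integral_le Real.continuous_exp.continuousOn isClosed_univ
      (by simp) (integrable_of_abs_le (by fun_prop) (hB2 x))
      (integrable_exp_of_abs_le (by fun_prop) (hB2 x))

lemma gauss1 {g : ℝ → ℝ} (hg : Measurable g) {B L : ℝ} (hB : ∀ x, |g x| ≤ B)
    (hL : ∀ x y, |g x - g y| ≤ L * |x - y|) (l : ℝ) :
    ∫ x, Real.exp (l * (g x - ∫ y, g y ∂(gaussianReal 0 1))) ∂(gaussianReal 0 1) ≤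
      Real.exp (l ^ 2 * L ^ 2) := by
  refine (jensen_symm hg hB l).trans ?_
  set γ := gaussianReal 0 1
  have hB2 : ∀ (l : ℝ) (p : ℝ × ℝ), |l * (g p.1 - g p.2)| ≤ |l| * (B + B) := by
    intro l p
    rw [abs_mul]
    gcongr
    exact (abs_sub _ _).trans (add_le_add (hB _) (hB _))
  have hInt : ∀ l : ℝ, Integrable (fun p : ℝ × ℝ => Real.exp (l * (g p.1 - g p.2))) (γ.prod γ) :=
    fun l => integrable_exp_of_abs_le (by fun_prop) (hB2 l)
  have hswap : ∫ p, Real.exp (l * (g p.1 - g p.2)) ∂(γ.prod γ) =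
      ∫ p, Real.exp ((-l) * (g p.1 - g p.2)) ∂(γ.prod γ) := by
    rw [← integral_prod_swap]
    congr 1; ext p; simp only [Prod.fst_swap, Prod.snd_swap]; congr 1; ring
  have hmg : ∀ c : ℝ, ∫ x, Real.exp (c * x) ∂γ = Real.exp (c ^ 2 / 2) := by
    intro c
    have := mgf_gaussianReal (p := γ) (X := id) (μ := 0) (v := 1) (by simp [γ]) c
    simpa [mgf] using this
  have hgi : ∀ c : ℝ, Integrable (fun p : ℝ × ℝ => Real.exp (c * p.1) * Real.exp ((-c) * p.2))
      (γ.prod γ) := fun c =>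
    (integrable_exp_mul_gaussianReal c).mul_prod (integrable_exp_mul_gaussianReal (-c))
  have hgv : ∀ c : ℝ, ∫ p : ℝ × ℝ, Real.exp (c * p.1) * Real.exp ((-c) * p.2) ∂(γ.prod γ) =
      Real.exp (c ^ 2) := by
    intro c
    rw [integral_prod_mul (fun x => Real.exp (c * x)) (fun y => Real.exp ((-c) * y)), hmg, hmg,
      ← Real.exp_add]
    congr 1; ring
  have h2 : ∫ p, (Real.exp (l * (g p.1 - g p.2)) + Real.exp ((-l) * (g p.1 - g p.2))) ∂(γ.prod γ)
      ≤ ∫ p : ℝ × ℝ, (Real.exp ((l * L) * p.1) * Real.exp ((-(l * L)) * p.2) +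
        Real.exp ((-(l * L)) * p.1) * Real.exp ((-(-(l * L))) * p.2)) ∂(γ.prod γ) := by
    refine integral_mono ((hInt l).add (hInt (-l))) ((hgi (l * L)).add (hgi (-(l * L)))) ?_
    intro p
    have hc : |l * (g p.1 - g p.2)| ≤ |l * L * (p.1 - p.2)| := by
      rw [abs_mul, mul_assoc, abs_mul l]
      have h3 := hL p.1 p.2
      have h4 : L * |p.1 - p.2| ≤ |L * (p.1 - p.2)| := by
        rw [abs_mul]; gcongr; exact le_abs_self L
      exact mul_le_mul_of_nonneg_left (h3.trans h4) (abs_nonneg l)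
    have h5 := Real.cosh_le_cosh.mpr hc
    rw [Real.cosh_eq, Real.cosh_eq] at h5
    simp only [← Real.exp_add]
    have e1 : (-l) * (g p.1 - g p.2) = -(l * (g p.1 - g p.2)) := by ring
    have e2 : l * L * p.1 + (-(l * L)) * p.2 = l * L * (p.1 - p.2) := by ring
    have e3 : (-(l * L)) * p.1 + -(-(l * L)) * p.2 = -(l * L * (p.1 - p.2)) := by ring
    rw [e1, e2, e3]
    linarith
  rw [integral_add (hInt l) (hInt (-l)), integral_add (hgi _) (hgi _), hgv, hgv, ← hswap] at h2
  have e4 : l ^ 2 * L ^ 2 = (l * L) ^ 2 := by ring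
  have e5 : (-(l * L)) ^ 2 = (l * L) ^ 2 := by ring
  rw [e5] at h2
  rw [e4]
  linarith

lemma gaussN (n : ℕ) : ∀ {f : (Fin n → ℝ) → ℝ} (_ : Measurable f) {B L : ℝ}
    (_ : ∀ x, |f x| ≤ B) (_ : ∀ x y, |f x - f y| ≤ L * ∑ k, |x k - y k|) (l : ℝ),
    ∫ x, Real.exp (l * (f x - ∫ y, f y ∂(Measure.pi fun _ => gaussianReal 0 1)))
      ∂(Measure.pi fun _ => gaussianReal 0 1) ≤ Real.exp (n * (l ^ 2 * L ^ 2)) := by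
  induction n with
  | zero =>
    intro f hf B L hB hL l
    have : ∀ x y : Fin 0 → ℝ, f x = f y := fun x y => by rw [Subsingleton.elim x y]
    have h1 : ∀ x : Fin 0 → ℝ, f x - ∫ y, f y ∂(Measure.pi fun _ => gaussianReal 0 1) = 0 := by
      intro x
      rw [integral_congr_ae (Eventually.of_forall fun y => this y x)]
      simp
    simp [h1]
  | succ n ih =>
    intro f hf B L hB hL l
    set ν : Measure (Fin n → ℝ) := Measure.pi fun _ => gaussianReal 0 1 with hν
    set γ := gaussianReal 0 1 with hγ
    let e := MeasurableEquiv.piFinSuccAbove (fun _ : Fin (n+1) => ℝ) 0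
    have hmp : MeasurePreserving e.symm (γ.prod ν) (Measure.pi fun _ => gaussianReal 0 1) :=
      (measurePreserving_piFinSuccAbove (fun _ : Fin (n+1) => gaussianReal 0 1) 0).symm
    have hI : ∀ φ : (Fin (n+1) → ℝ) → ℝ, ∫ x, φ x ∂(Measure.pi fun _ => gaussianReal 0 1) =
        ∫ p, φ (e.symm p) ∂(γ.prod ν) := fun φ => (hmp.integral_comp' φ).symm
    have hes : ∀ p, e.symm p = Fin.cons p.1 p.2 := by
      intro p
      simp [e, MeasurableEquiv.piFinSuccAbove, Fin.insertNthEquiv]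
    rw [hI, hI]
    set F : ℝ × (Fin n → ℝ) → ℝ := fun p => f (e.symm p) with hF
    have hFm : Measurable F := hf.comp e.symm.measurable
    have hFB : ∀ p, |F p| ≤ B := fun p => hB _
    have hFx : ∀ x x' y, |F (x, y) - F (x', y)| ≤ L * |x - x'| := by
      intro x x' y
      refine (hL _ _).trans (le_of_eq ?_)
      rw [hes, hes, Fin.sum_univ_succ]
      simp
    have hFy : ∀ x y y', |F (x, y) - F (x, y')| ≤ L * ∑ k, |y k - y' k| := by
      intro x y y'
      refine (hL _ _).trans (le_of_eq ?_)
      rw [hes, hes, Fin.sum_univ_succ]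
      simp
    have hFi : Integrable F (γ.prod ν) := integrable_of_abs_le hFm hFB
    set g : ℝ → ℝ := fun x => ∫ y, F (x, y) ∂ν with hg
    have hgm : Measurable g := (hFm.stronglyMeasurable.integral_prod_right').measurable
    have hgB : ∀ x, |g x| ≤ B := fun x => abs_integral_le_of_abs_le (fun y => hFB (x, y))
    have hgL : ∀ x x', |g x - g x'| ≤ L * |x - x'| := by
      intro x x'
      have h1 : ∀ x, Integrable (fun y => F (x, y)) ν := fun x =>
        integrable_of_abs_le (hFm.comp measurable_prodMk_left) (fun y => hFB (x, y))
      simp only [hg]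
      rw [← integral_sub (h1 x) (h1 x')]
      exact abs_integral_le_of_abs_le (fun y => hFx x x' y)
    have hm : ∫ p, F p ∂(γ.prod ν) = ∫ x, g x ∂γ := integral_prod _ hFi
    have hmB : |∫ x, g x ∂γ| ≤ B := abs_integral_le_of_abs_le hgB
    have hE : Integrable (fun p => Real.exp (l * (F p - ∫ x, g x ∂γ))) (γ.prod ν) := by
      refine integrable_exp_of_abs_le (B := |l| * (B + B)) (by fun_prop) (fun p => ?_)
      rw [abs_mul]
      gcongr
      exact (abs_sub _ _).trans (add_le_add (hFB _) hmB)
    change ∫ p, Real.exp (l * (F p - ∫ p, F p ∂(γ.prod ν))) ∂(γ.prod ν) ≤ _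
    rw [hm, integral_prod _ hE]
    have hstep : ∀ x, ∫ y, Real.exp (l * (F (x, y) - ∫ x, g x ∂γ)) ∂ν ≤
        Real.exp (l * (g x - ∫ x, g x ∂γ)) * Real.exp (n * (l ^ 2 * L ^ 2)) := by
      intro x
      have h1 : ∀ y, Real.exp (l * (F (x, y) - ∫ x, g x ∂γ)) =
          Real.exp (l * (g x - ∫ x, g x ∂γ)) * Real.exp (l * (F (x, y) - g x)) := by
        intro y; rw [← Real.exp_add]; congr 1; ring
      simp only [h1]
      rw [integral_const_mul]
      gcongr
      exact ih (hFm.comp measurable_prodMk_left) (fun y => hFB (x, y)) (hFy x) l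
    have hgE : Integrable (fun x => Real.exp (l * (g x - ∫ x, g x ∂γ))) γ := by
      refine integrable_exp_of_abs_le (B := |l| * (B + B)) (by fun_prop) (fun p => ?_)
      rw [abs_mul]
      gcongr
      exact (abs_sub _ _).trans (add_le_add (hgB _) hmB)
    calc _ ≤ ∫ x, Real.exp (l * (g x - ∫ x, g x ∂γ)) * Real.exp (n * (l ^ 2 * L ^ 2)) ∂γ :=
          integral_mono hE.integral_prod_left (hgE.mul_const _) hstep
      _ = (∫ x, Real.exp (l * (g x - ∫ x, g x ∂γ)) ∂γ) * Real.exp (n * (l ^ 2 * L ^ 2)) :=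
          integral_mul_const _ _
      _ ≤ Real.exp (l ^ 2 * L ^ 2) * Real.exp (n * (l ^ 2 * L ^ 2)) := by
          gcongr
          exact gauss1 hgm hgB hgL l
      _ = _ := by
          rw [← Real.exp_add]; congr 1; push_cast; ring

lemma tail_of_mgf {Ω : Type*} [MeasurableSpace Ω] {μ : Measure Ω} [IsProbabilityMeasure μ]
    {X : Ω → ℝ} (hX : Measurable X) {B m V K : ℝ} (hB : ∀ x, |X x| ≤ B) (hV : 0 < V)
    (h : ∀ l : ℝ, ∫ x, Real.exp (l * (X x - m)) ∂μ ≤ K * Real.exp (l ^ 2 * V)) {r : ℝ}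
    (hr : 0 ≤ r) :
    μ {x | r ≤ |X x - m|} ≤ ENNReal.ofReal (2 * K * Real.exp (-r ^ 2 / (4 * V))) := by
  have hInt : ∀ c : ℝ, Integrable (fun x => Real.exp (c * (X x - m))) μ := by
    intro c
    refine integrable_exp_of_abs_le (B := |c| * (B + |m|)) (by fun_prop) (fun p => ?_)
    rw [abs_mul]
    gcongr
    exact (abs_sub _ _).trans (add_le_add (hB _) le_rfl)
  have hl : 0 ≤ r / (2 * V) := by positivity
  have h1 : μ.real {x | r ≤ X x - m} ≤ K * Real.exp (-r ^ 2 / (4 * V)) := by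
    refine (measure_ge_le_exp_mul_mgf (X := fun x => X x - m) r hl (hInt _)).trans ?_
    calc _ ≤ Real.exp (-(r / (2 * V)) * r) * (K * Real.exp ((r / (2 * V)) ^ 2 * V)) := by
          gcongr; exact h _
      _ = K * Real.exp (-(r / (2 * V)) * r + (r / (2 * V)) ^ 2 * V) := by rw [Real.exp_add]; ring
      _ = _ := by congr 2; field_simp; ring
  have h2 : μ.real {x | r ≤ -(X x - m)} ≤ K * Real.exp (-r ^ 2 / (4 * V)) := by
    refine (measure_ge_le_exp_mul_mgf (X := fun x => -(X x - m)) r hl ?_).trans ?_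
    · refine (hInt (-(r / (2 * V)))).congr (Eventually.of_forall fun x => ?_)
      simp only; congr 1; ring
    calc _ ≤ Real.exp (-(r / (2 * V)) * r) * (K * Real.exp ((-(r / (2 * V))) ^ 2 * V)) := by
          gcongr
          refine le_trans (le_of_eq ?_) (h _)
          unfold mgf
          congr 1; ext x; ring_nf
      _ = K * Real.exp (-(r / (2 * V)) * r + (r / (2 * V)) ^ 2 * V) := by rw [Real.exp_add]; ring_nf
      _ = _ := by congr 2; field_simp; ring
  have h3 : {x | r ≤ |X x - m|} ⊆ {x | r ≤ X x - m} ∪ {x | r ≤ -(X x - m)} := by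
    intro x hx
    have hx' : r ≤ |X x - m| := hx
    exact le_abs.mp hx'
  rw [← ofReal_measureReal]
  apply ENNReal.ofReal_le_ofReal
  calc _ ≤ μ.real ({x | r ≤ X x - m} ∪ {x | r ≤ -(X x - m)}) := measureReal_mono h3
    _ ≤ _ := measureReal_union_le _ _
    _ ≤ _ := by linarith

/-! ### Concentration on the symmetric group -/

lemma fin_jensen_symm {ι : Type*} [Fintype ι] [Nonempty ι] (g : ι → ℝ) {D : ℝ}
    (hD : ∀ i j, |g i - g j| ≤ D) (l : ℝ) :
    ∑ i, Real.exp (l * (g i - (∑ j, g j) / Fintype.card ι)) ≤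
      Fintype.card ι * Real.exp (l ^ 2 * D ^ 2 / 2) := by
  set n : ℝ := ((Fintype.card ι : ℕ) : ℝ) with hn
  have hn0 : 0 < n := by rw [hn]; exact_mod_cast Fintype.card_pos
  have h1 : ∀ i, Real.exp (l * (g i - (∑ j, g j) / n)) ≤ (1 / n) * ∑ j, Real.exp (l * (g i - g j)) := by
    intro i
    have := convexOn_exp.map_sum_le (t := Finset.univ) (w := fun _ : ι => 1 / n)
      (p := fun j => l * (g i - g j)) (fun _ _ => by positivity)
      (by simp [← hn]) (by simp)
    simp only [smul_eq_mul, ← Finset.mul_sum, Finset.sum_sub_distrib] at this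
    refine le_trans (le_of_eq ?_) this
    congr 1
    simp only [Finset.sum_const, Finset.card_univ, nsmul_eq_mul, ← hn]
    field_simp
  have h2 : ∑ i, ∑ j, Real.exp (l * (g i - g j)) ≤ n * n * Real.exp (l ^ 2 * D ^ 2 / 2) := by
    have h3 : ∑ i, ∑ j, Real.exp (l * (g i - g j)) = ∑ i, ∑ j, Real.exp (-(l * (g i - g j))) := by
      rw [Finset.sum_comm]
      refine Finset.sum_congr rfl fun i _ => Finset.sum_congr rfl fun j _ => ?_
      congr 1; ring
    have h4 : ∑ i, ∑ j, Real.exp (l * (g i - g j)) = ∑ i, ∑ j, Real.cosh (l * (g i - g j)) := by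
      simp only [Real.cosh_eq, ← Finset.sum_div, Finset.sum_add_distrib]
      rw [← h3]; ring
    rw [h4]
    calc _ ≤ ∑ i : ι, ∑ j : ι, Real.exp (l ^ 2 * D ^ 2 / 2) := by
          refine Finset.sum_le_sum fun i _ => Finset.sum_le_sum fun j _ => ?_
          refine (Real.cosh_le_exp_half_sq _).trans (Real.exp_le_exp.mpr ?_)
          rw [mul_pow]
          have := sq_le_sq' (by linarith [neg_abs_le (g i - g j), hD i j])
            ((le_abs_self _).trans (hD i j))
          gcongr
      _ = _ := by simp [← hn]; ring
  calc _ ≤ ∑ i, (1 / n) * ∑ j, Real.exp (l * (g i - g j)) := Finset.sum_le_sum fun i _ => h1 i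
    _ = (1 / n) * ∑ i, ∑ j, Real.exp (l * (g i - g j)) := by rw [Finset.mul_sum]
    _ ≤ (1 / n) * (n * n * Real.exp (l ^ 2 * D ^ 2 / 2)) := by gcongr
    _ = _ := by field_simp

lemma dec_swap {n : ℕ} (p : Fin (n + 1)) (e : Equiv.Perm (Fin n)) :
    Equiv.Perm.decomposeFin.symm (p, e) =
      Equiv.swap 0 p * Equiv.Perm.decomposeFin.symm ((0 : Fin (n + 1)), e) := by
  ext x
  refine Fin.cases ?_ (fun y => ?_) x
  · simp [Equiv.Perm.decomposeFin_symm_apply_zero]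
  · simp [Equiv.Perm.decomposeFin_symm_apply_succ]

lemma dec_swap_mul {n : ℕ} (p : Fin (n + 1)) (e : Equiv.Perm (Fin n)) (a b : Fin n) :
    Equiv.Perm.decomposeFin.symm (p, Equiv.swap a b * e) =
      Equiv.swap (Equiv.swap 0 p a.succ) (Equiv.swap 0 p b.succ) *
        Equiv.Perm.decomposeFin.symm (p, e) := by
  have hne : ∀ a : Fin n, p ≠ Equiv.swap 0 p a.succ := by
    intro a h
    have h2 : Equiv.swap 0 p 0 = Equiv.swap 0 p a.succ := by
      rw [Equiv.swap_apply_left]; exact h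
    exact (Fin.succ_ne_zero a) ((Equiv.swap 0 p).injective h2).symm
  ext x
  refine Fin.cases ?_ (fun y => ?_) x
  · rw [Equiv.Perm.mul_apply, Equiv.Perm.decomposeFin_symm_apply_zero,
      Equiv.Perm.decomposeFin_symm_apply_zero, Equiv.swap_apply_of_ne_of_ne (hne a) (hne b)]
  · rw [Equiv.Perm.mul_apply, Equiv.Perm.decomposeFin_symm_apply_succ,
      Equiv.Perm.decomposeFin_symm_apply_succ, Equiv.Perm.mul_apply,
      ← (Equiv.swap 0 p).injective.map_swap, ← (Fin.succ_injective n).map_swap]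

lemma perm_conc (n : ℕ) : ∀ (f : Equiv.Perm (Fin n) → ℝ) {c : ℝ}
    (_ : ∀ σ a b, |f (Equiv.swap a b * σ) - f σ| ≤ c) (l : ℝ),
    ∑ σ, Real.exp (l * (f σ - (∑ τ, f τ) / n.factorial)) ≤
      n.factorial * Real.exp (n * (2 * (l ^ 2 * c ^ 2))) := by
  induction n with
  | zero =>
    intro f c _ l
    have h : ∀ σ : Equiv.Perm (Fin 0), f σ = f 1 := fun σ => by rw [Subsingleton.elim σ 1]
    simp [h]
  | succ n ih =>
    intro f c hf l
    let dec := (Equiv.Perm.decomposeFin (n := n))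
    have hs : ∀ φ : Equiv.Perm (Fin (n+1)) → ℝ, ∑ σ, φ σ = ∑ p, ∑ e, φ (dec.symm (p, e)) := by
      intro φ
      rw [← dec.symm.sum_comp, Fintype.sum_prod_type]
    have hn0 : (0:ℝ) < n.factorial := by exact_mod_cast n.factorial_pos
    let G : Fin (n+1) → Equiv.Perm (Fin n) → ℝ := fun p e => f (dec.symm (p, e))
    let g : Fin (n+1) → ℝ := fun p => (∑ e, G p e) / n.factorial
    have hG : ∀ p p' e, |G p e - G p' e| ≤ 2 * c := by
      have h0 : ∀ p e, |G p e - G 0 e| ≤ c := by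
        intro p e
        simp only [G, dec]
        rw [dec_swap p e]
        exact hf _ _ _
      intro p p' e
      have h1 := h0 p e
      have h2 := h0 p' e
      rw [abs_le] at *
      constructor <;> linarith [h1.1, h1.2, h2.1, h2.2]
    have hg : ∀ p p', |g p - g p'| ≤ 2 * c := by
      intro p p'
      have h1 : g p - g p' = (∑ e, (G p e - G p' e)) / n.factorial := by
        simp only [g, Finset.sum_sub_distrib]; ring
      rw [h1, abs_div, abs_of_pos hn0, div_le_iff₀ hn0]
      refine (Finset.abs_sum_le_sum_abs _ _).trans ?_
      refine (Finset.sum_le_sum fun e _ => hG p p' e).trans (le_of_eq ?_)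
      simp [Fintype.card_perm]; ring
    have hm : (∑ τ, f τ) / ((n+1).factorial : ℝ) = (∑ p, g p) / (Fintype.card (Fin (n+1)) : ℝ) := by
      rw [hs f]
      simp only [g, G]
      rw [← Finset.sum_div, div_div, Fintype.card_fin, Nat.factorial_succ]
      push_cast
      ring
    rw [hm, hs]
    set m := (∑ p, g p) / (Fintype.card (Fin (n+1)) : ℝ) with hmd
    have hstep : ∀ p, ∑ e, Real.exp (l * (f (dec.symm (p, e)) - m)) ≤
        Real.exp (l * (g p - m)) * (n.factorial * Real.exp (n * (2 * (l ^ 2 * c ^ 2)))) := by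
      intro p
      have h1 : ∀ e, Real.exp (l * (f (dec.symm (p, e)) - m)) =
          Real.exp (l * (g p - m)) * Real.exp (l * (G p e - g p)) := by
        intro e; rw [← Real.exp_add]; congr 1; simp only [G]; ring
      simp only [h1]
      rw [← Finset.mul_sum]
      gcongr
      refine ih (G p) (fun σ a b => ?_) l
      simp only [G, dec]
      rw [dec_swap_mul]
      exact hf _ _ _
    calc _ ≤ ∑ p, Real.exp (l * (g p - m)) *
          (n.factorial * Real.exp (n * (2 * (l ^ 2 * c ^ 2)))) :=
          Finset.sum_le_sum fun p _ => hstep p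
      _ = (∑ p, Real.exp (l * (g p - m))) *
          (n.factorial * Real.exp (n * (2 * (l ^ 2 * c ^ 2)))) := by rw [Finset.sum_mul]
      _ ≤ (Fintype.card (Fin (n+1)) * Real.exp (l ^ 2 * (2 * c) ^ 2 / 2)) *
          (n.factorial * Real.exp (n * (2 * (l ^ 2 * c ^ 2)))) := by
          gcongr
          exact fin_jensen_symm g hg l
      _ = _ := by
          rw [Fintype.card_fin, Nat.factorial_succ]
          have : Real.exp (((n + 1 : ℕ) : ℝ) * (2 * (l ^ 2 * c ^ 2))) =
            Real.exp (l ^ 2 * (2 * c) ^ 2 / 2) * Real.exp (n * (2 * (l ^ 2 * c ^ 2))) := by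
            rw [← Real.exp_add]; congr 1; push_cast; ring
          rw [this]; push_cast; ring

lemma perm_conc' {α : Type*} [Fintype α] [DecidableEq α] (f : Equiv.Perm α → ℝ) {c : ℝ}
    (hf : ∀ σ a b, |f (Equiv.swap a b * σ) - f σ| ≤ c) (l : ℝ) :
    ∑ σ, Real.exp (l * (f σ - (∑ τ, f τ) / (Fintype.card α).factorial)) ≤
      (Fintype.card α).factorial * Real.exp (Fintype.card α * (2 * (l ^ 2 * c ^ 2))) := by
  let e : Fin (Fintype.card α) ≃ α := (Fintype.equivFin α).symm
  have hs : ∀ φ : Equiv.Perm α → ℝ, ∑ σ, φ σ = ∑ σ : Equiv.Perm (Fin (Fintype.card α)),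
      φ (e.permCongr σ) := fun φ => (e.permCongr.sum_comp φ).symm
  rw [hs, hs]
  refine perm_conc _ (fun σ => f (e.permCongr σ)) (fun σ a b => ?_) l
  have : e.permCongr (Equiv.swap a b * σ) = Equiv.swap (e a) (e b) * e.permCongr σ := by
    ext x
    simp only [Equiv.permCongr_apply, Equiv.Perm.mul_apply]
    rw [e.injective.map_swap]
  rw [this]
  exact hf _ _ _

set_option linter.unusedSectionVars false

/-! ### The configuration model: most pairings are not far from simple -/

section Switch
variable {α β : Type*} [Fintype α] [DecidableEq α] [DecidableEq β]

/-- The half-edge `q` lies on a loop or on a multiple edge of the pairing `ρ`. -/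
def Bad (v : α → β) (ρ : Equiv.Perm α) (q : α) : Prop :=
  v (ρ q) = v q ∨ ∃ q2, q2 ≠ q ∧ v q2 = v q ∧ v (ρ q2) = v (ρ q)

/-- Number of bad half-edges. -/
def nBad (v : α → β) (ρ : Equiv.Perm α) : ℕ := (Finset.univ.filter (fun q => Bad v ρ q)).card

/-- The switching of `ρ` along the half-edges `q`, `r`. -/
def sw (ρ : Equiv.Perm α) (q r : α) : Equiv.Perm α := Equiv.swap q r * ρ * Equiv.swap q r

/-- Choices of `r` that make the switching controlled. -/
def Nice0 (v : α → β) (ρ : Equiv.Perm α) (q r : α) : Prop :=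
  v r ≠ v (ρ q) ∧ v r ≠ v q ∧ v (ρ r) ≠ v (ρ q) ∧ v (ρ r) ≠ v q ∧
    (∀ x, v x = v (ρ q) → v (ρ x) ≠ v r) ∧ (∀ x, v x = v q → v (ρ x) ≠ v (ρ r))

lemma sw_other {ρ : Equiv.Perm α} {q r x : α} (hi : ∀ x, ρ (ρ x) = x)
    (h1 : x ≠ q) (h2 : x ≠ r) (h3 : x ≠ ρ q) (h4 : x ≠ ρ r) : sw ρ q r x = ρ x := by
  have h5 : ρ x ≠ q := fun h => h3 (by rw [← h, hi])
  have h6 : ρ x ≠ r := fun h => h4 (by rw [← h, hi])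
  simp [sw, Equiv.swap_apply_of_ne_of_ne h1 h2, Equiv.swap_apply_of_ne_of_ne h5 h6]

lemma sw_invol {ρ : Equiv.Perm α} {q r : α} (hi : ∀ x, ρ (ρ x) = x) (x : α) :
    sw ρ q r (sw ρ q r x) = x := by
  simp [sw, hi]

lemma sw_left {v : α → β} {ρ : Equiv.Perm α} {q r : α} (hf : ∀ x, ρ x ≠ x)
    (h : Nice0 v ρ q r) : sw ρ q r q = ρ r := by
  obtain ⟨h1, h2, h3, h4, _, _⟩ := h
  have h5 : ρ r ≠ q := fun h => h4 (by rw [h])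
  simp [sw, Equiv.swap_apply_of_ne_of_ne h5 (hf r)]

lemma sw_right {v : α → β} {ρ : Equiv.Perm α} {q r : α} (hf : ∀ x, ρ x ≠ x)
    (h : Nice0 v ρ q r) : sw ρ q r r = ρ q := by
  obtain ⟨h1, h2, h3, h4, _, _⟩ := h
  have h5 : ρ q ≠ r := fun h => h1 (by rw [h])
  simp [sw, Equiv.swap_apply_of_ne_of_ne (hf q) h5]

lemma bad_symm {v : α → β} {ρ : Equiv.Perm α} (hi : ∀ x, ρ (ρ x) = x) {x : α}
    (h : Bad v ρ x) : Bad v ρ (ρ x) := by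
  rcases h with h | ⟨y, hy1, hy2, hy3⟩
  · left; rw [hi, h]
  · right
    refine ⟨ρ y, fun h => hy1 (ρ.injective h), hy3, ?_⟩
    rw [hi, hi, hy2]

/-- Half-edges `r` from which a switching could have come. -/
def Rev (v : α → β) (ρ : Equiv.Perm α) (q r : α) : Prop :=
  v (ρ r) = v q ∨ ∃ q2, v q2 = v q ∧ v (ρ r) = v (ρ q2)

lemma sw_rev {v : α → β} {ρ : Equiv.Perm α} {q r : α} (hi : ∀ x, ρ (ρ x) = x)
    (hf : ∀ x, ρ x ≠ x) (h : Nice0 v ρ q r) (hb : Bad v ρ q) : Rev v (sw ρ q r) q r := by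
  have hr := sw_right hf h
  obtain ⟨h1, h2, h3, h4, h5, h6⟩ := h
  unfold Rev
  rw [hr]
  by_cases hl : v (ρ q) = v q
  · exact Or.inl hl
  · right
    rcases hb with hb | ⟨q2, hq, hq2, hq3⟩
    · exact absurd hb hl
    · refine ⟨q2, hq2, ?_⟩
      rw [sw_other hi hq, hq3]
      · intro h; exact h2 (by rw [← h, hq2])
      · intro h; exact hl (by rw [← h, hq2])
      · intro h; exact h4 (by rw [← h, hq2])

lemma sw_mono {v : α → β} {ρ : Equiv.Perm α} {q r : α} (hi : ∀ x, ρ (ρ x) = x)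
    (hf : ∀ x, ρ x ≠ x) (h : Nice0 v ρ q r) (hnb : ¬ Bad v ρ r) {x : α}
    (hx : Bad v (sw ρ q r) x) : Bad v ρ x ∧ x ≠ q := by
  have hr := sw_right hf h
  have hq := sw_left hf h
  have hi' := sw_invol (q := q) (r := r) hi
  have hp : sw ρ q r (ρ q) = r := by rw [← hr, hi']
  have hs : sw ρ q r (ρ r) = q := by rw [← hq, hi']
  have hrs : v (ρ r) ≠ v r := fun h => hnb (Or.inl h)
  obtain ⟨h1, h2, h3, h4, h5, h6⟩ := h
  have bp : ¬ Bad v (sw ρ q r) (ρ q) := by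
    rintro (hb | ⟨y, hy1, hy2, hy3⟩)
    · rw [hp] at hb; exact h1 hb
    · rw [hp] at hy3
      by_cases e1 : y = q
      · subst e1; rw [hq] at hy3; exact hrs hy3
      by_cases e2 : y = r
      · subst e2; exact h1 hy2
      by_cases e4 : y = ρ r
      · subst e4; exact h3 hy2
      rw [sw_other hi e1 e2 hy1 e4] at hy3
      exact h5 y hy2 hy3
  have bq : ¬ Bad v (sw ρ q r) q := by
    rintro (hb | ⟨y, hy1, hy2, hy3⟩)
    · rw [hq] at hb; exact h4 hb
    · rw [hq] at hy3
      by_cases e1 : y = ρ q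
      · subst e1; rw [hp] at hy3; exact hrs hy3.symm
      by_cases e2 : y = r
      · subst e2; exact h2 hy2
      by_cases e4 : y = ρ r
      · subst e4; exact h4 hy2
      rw [sw_other hi hy1 e2 e1 e4] at hy3
      exact h6 y hy2 hy3
  have br : ¬ Bad v (sw ρ q r) r := by
    intro hb
    have := bad_symm hi' hb
    rw [hr] at this
    exact bp this
  have bs : ¬ Bad v (sw ρ q r) (ρ r) := by
    intro hb
    have := bad_symm hi' hb
    rw [hs] at this
    exact bq this
  have hne : ∀ y, Bad v (sw ρ q r) y → sw ρ q r y = ρ y := by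
    intro y hy
    refine sw_other hi ?_ ?_ ?_ ?_ <;> (rintro rfl; contradiction)
  refine ⟨?_, fun h => bq (h ▸ hx)⟩
  have hxe := hne x hx
  rcases hx with hb | ⟨y, hy1, hy2, hy3⟩
  · left; rw [← hxe]; exact hb
  · right
    have hyb : Bad v (sw ρ q r) y := Or.inr ⟨x, hy1.symm, hy2.symm, hy3.symm⟩
    refine ⟨y, hy1, hy2, ?_⟩
    rw [← hne y hyb, ← hxe]; exact hy3

lemma nBad_sw {v : α → β} {ρ : Equiv.Perm α} {q r : α} (hi : ∀ x, ρ (ρ x) = x)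
    (hf : ∀ x, ρ x ≠ x) (h : Nice0 v ρ q r) (hnb : ¬ Bad v ρ r) (hb : Bad v ρ q) :
    nBad v (sw ρ q r) < nBad v ρ := by
  unfold nBad
  apply Finset.card_lt_card
  rw [Finset.ssubset_iff_of_subset]
  · refine ⟨q, by simpa using hb, ?_⟩
    simp only [Finset.mem_filter, Finset.mem_univ, true_and]
    intro hx
    exact (sw_mono hi hf h hnb hx).2 rfl
  · intro x
    simp only [Finset.mem_filter, Finset.mem_univ, true_and]
    intro hx
    exact (sw_mono hi hf h hnb hx).1

lemma card_pull {v : α → β} {d : ℕ} (hv : ∀ b, (Finset.univ.filter (fun x => v x = b)).card ≤ d)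
    (ρ : Equiv.Perm α) (b : β) : (Finset.univ.filter (fun x => v (ρ x) = b)).card ≤ d := by
  refine le_trans (le_of_eq ?_) (hv b)
  refine Finset.card_bij (fun x _ => ρ x) ?_ ?_ ?_
  · intro x hx; simpa using hx
  · intro x _ y _ h; exact ρ.injective h
  · intro y hy; exact ⟨ρ.symm y, by simpa using hy, by simp⟩

lemma card_union_fib {v : α → β} {d : ℕ}
    (hv : ∀ b, (Finset.univ.filter (fun x => v x = b)).card ≤ d)
    (ρ τ : Equiv.Perm α) (b : β) :
    (Finset.univ.filter (fun r => ∃ x, v x = b ∧ v (τ r) = v (ρ x))).card ≤ d * d := by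
  have h : (Finset.univ.filter (fun r => ∃ x, v x = b ∧ v (τ r) = v (ρ x))) ⊆
      (Finset.univ.filter (fun x => v x = b)).biUnion
        (fun x => Finset.univ.filter (fun r => v (τ r) = v (ρ x))) := by
    intro r
    simp
  refine (Finset.card_le_card h).trans (Finset.card_biUnion_le.trans ?_)
  refine (Finset.sum_le_sum fun x _ => card_pull hv τ (v (ρ x))).trans ?_
  rw [Finset.sum_const, smul_eq_mul]
  exact Nat.mul_le_mul_right _ (hv b)

lemma card_rev {v : α → β} {d : ℕ}
    (hv : ∀ b, (Finset.univ.filter (fun x => v x = b)).card ≤ d)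
    (ρ : Equiv.Perm α) (q : α) :
    (Finset.univ.filter (fun r => Rev v ρ q r)).card ≤ d + d * d := by
  refine le_trans (Finset.card_le_card ?_) ((Finset.card_union_le
    (Finset.univ.filter (fun r => v (ρ r) = v q))
    (Finset.univ.filter (fun r => ∃ x, v x = v q ∧ v (ρ r) = v (ρ x)))).trans
    (add_le_add (card_pull hv ρ (v q)) (card_union_fib hv ρ ρ (v q))))
  intro r hr
  have hr' : Rev v ρ q r := (Finset.mem_filter.mp hr).2
  simpa [Rev] using hr'

lemma card_not_nice {v : α → β} {d : ℕ}
    (hv : ∀ b, (Finset.univ.filter (fun x => v x = b)).card ≤ d)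
    (ρ : Equiv.Perm α) (q : α) :
    (Finset.univ.filter (fun r => ¬ Nice0 v ρ q r)).card ≤ 4 * d + 2 * (d * d) := by
  have h : (Finset.univ.filter (fun r => ¬ Nice0 v ρ q r)) ⊆
      (Finset.univ.filter (fun r => v r = v (ρ q))) ∪ (Finset.univ.filter (fun r => v r = v q)) ∪
      (Finset.univ.filter (fun r => v (ρ r) = v (ρ q))) ∪
      (Finset.univ.filter (fun r => v (ρ r) = v q)) ∪
      (Finset.univ.filter (fun r => ∃ x, v x = v (ρ q) ∧ v ((1 : Equiv.Perm α) r) = v (ρ x))) ∪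
      (Finset.univ.filter (fun r => ∃ x, v x = v q ∧ v (ρ r) = v (ρ x))) := by
    intro r h
    replace h := (Finset.mem_filter.mp h).2
    simp only [Finset.mem_filter, Finset.mem_univ, true_and, Finset.mem_union,
      Equiv.Perm.one_apply]
    by_contra h2
    push Not at h2
    obtain ⟨⟨⟨⟨⟨a1, a2⟩, a3⟩, a4⟩, a5⟩, a6⟩ := h2
    exact h ⟨a1, a2, a3, a4, fun x hx h => a5 (Finset.mem_filter.mpr ⟨Finset.mem_univ _, x, hx, h.symm⟩), fun x hx h => a6 x hx h.symm⟩
  refine (Finset.card_le_card h).trans ?_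
  have b1 := hv (v (ρ q))
  have b2 := hv (v q)
  have b3 := card_pull hv ρ (v (ρ q))
  have b4 := card_pull hv ρ (v q)
  have b5 := card_union_fib hv ρ 1 (v (ρ q))
  have b6 := card_union_fib hv ρ ρ (v q)
  refine (Finset.card_union_le _ _).trans ?_
  refine (add_le_add_left (Finset.card_union_le _ _) _).trans ?_
  refine (add_le_add_left (add_le_add_left (Finset.card_union_le _ _) _) _).trans ?_
  refine (add_le_add_left (add_le_add_left (add_le_add_left (Finset.card_union_le _ _) _) _) _).trans ?_
  refine (add_le_add_left (add_le_add_left (add_le_add_left (add_le_add_left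
    (Finset.card_union_le _ _) _) _) _) _).trans ?_
  omega

/-- The pairing attached to a permutation. -/
def pr (ρ0 σ : Equiv.Perm α) : Equiv.Perm α := σ * ρ0 * σ⁻¹

lemma pr_swap (ρ0 σ : Equiv.Perm α) (q r : α) : pr ρ0 (Equiv.swap q r * σ) = sw (pr ρ0 σ) q r := by
  unfold pr sw
  rw [_root_.mul_inv_rev, Equiv.swap_inv]
  simp only [mul_assoc]

lemma pr_invol {ρ0 : Equiv.Perm α} (hi : ∀ x, ρ0 (ρ0 x) = x) (σ : Equiv.Perm α) (x : α) :
    pr ρ0 σ (pr ρ0 σ x) = x := by simp [pr, hi]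

lemma pr_fpf {ρ0 : Equiv.Perm α} (hf : ∀ x, ρ0 x ≠ x) (σ : Equiv.Perm α) (x : α) :
    pr ρ0 σ x ≠ x := by
  intro h
  apply hf (σ⁻¹ x)
  have : σ (ρ0 (σ⁻¹ x)) = σ (σ⁻¹ x) := by simpa [pr] using h
  exact σ.injective this

lemma double_count {v : α → β} {d : ℕ}
    (hv : ∀ b, (Finset.univ.filter (fun x => v x = b)).card ≤ d) (ρ0 : Equiv.Perm α)
    (S S' : Finset (Equiv.Perm α)) (Nc : Equiv.Perm α → α → α → Prop) (c : ℕ)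
    (h1 : ∀ σ ∈ S, ∀ q r, Bad v (pr ρ0 σ) q → Nc σ q r →
      Equiv.swap q r * σ ∈ S' ∧ Rev v (sw (pr ρ0 σ) q r) q r)
    (h2 : ∀ σ ∈ S, ∀ q, Bad v (pr ρ0 σ) q → (Finset.univ.filter (fun r => ¬ Nc σ q r)).card ≤ c) :
    (∑ σ ∈ S, nBad v (pr ρ0 σ)) * (Fintype.card α - c) ≤
      S'.card * (Fintype.card α * (d + d * d)) := by
  let T1 : Finset (Σ _ : Equiv.Perm α, Σ _ : α, α) := S.sigma fun σ =>
    (Finset.univ.filter fun q => Bad v (pr ρ0 σ) q).sigma fun q =>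
      (Finset.univ.filter fun r => Nc σ q r)
  let T2 : Finset (Σ _ : Equiv.Perm α, Σ _ : α, α) := S'.sigma fun σ =>
    (Finset.univ : Finset α).sigma fun q => (Finset.univ.filter fun r => Rev v (pr ρ0 σ) q r)
  have hle : T1.card ≤ T2.card := by
    refine Finset.card_le_card_of_injOn
      (fun x => ⟨Equiv.swap x.2.1 x.2.2 * x.1, x.2⟩) ?_ ?_
    · rintro ⟨σ, q, r⟩ hx
      simp only [T1, Finset.coe_sigma, Set.mem_sigma_iff, Finset.mem_coe, Finset.mem_filter, Finset.mem_univ,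
        true_and] at hx
      simp only [T2, Finset.coe_sigma, Set.mem_sigma_iff, Finset.mem_coe, Finset.mem_filter, Finset.mem_univ,
        true_and]
      have := h1 σ hx.1 q r hx.2.1 hx.2.2
      exact ⟨this.1, by rw [pr_swap]; exact this.2⟩
    · rintro ⟨σ, q, r⟩ _ ⟨σ', q', r'⟩ _ h
      simp only [Sigma.mk.injEq, heq_eq_eq] at h
      obtain ⟨ha, hb⟩ := h
      obtain ⟨rfl, rfl⟩ := hb
      have := mul_left_cancel ha
      subst this
      rfl
  have hT1 : (∑ σ ∈ S, nBad v (pr ρ0 σ)) * (Fintype.card α - c) ≤ T1.card := by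
    simp only [T1]
    rw [Finset.card_sigma, Finset.sum_mul]
    refine Finset.sum_le_sum fun σ hσ => ?_
    rw [Finset.card_sigma]
    have : nBad v (pr ρ0 σ) * (Fintype.card α - c) =
      ∑ q ∈ (Finset.univ.filter fun q => Bad v (pr ρ0 σ) q), (Fintype.card α - c) := by
      rw [Finset.sum_const, smul_eq_mul]; rfl
    rw [this]
    refine Finset.sum_le_sum fun q hq => ?_
    have h3 := h2 σ hσ q (by simpa using hq)
    have h4 := Finset.card_filter_add_card_filter_not (s := (Finset.univ : Finset α)) (fun r => Nc σ q r)
    rw [Finset.card_univ] at h4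
    omega
  have hT2 : T2.card ≤ S'.card * (Fintype.card α * (d + d * d)) := by
    simp only [T2]
    rw [Finset.card_sigma]
    refine (Finset.sum_le_card_nsmul _ _ (Fintype.card α * (d + d * d)) fun σ _ => ?_).trans
      (by rw [smul_eq_mul])
    rw [Finset.card_sigma]
    refine (Finset.sum_le_card_nsmul _ _ (d + d * d) fun q _ => card_rev hv _ q).trans
      (by rw [smul_eq_mul, Finset.card_univ])
  exact hT1.trans (hle.trans hT2)

/-- Permutations whose pairing has at most `k` bad half-edges. -/
def Tk (v : α → β) (ρ0 : Equiv.Perm α) (k : ℕ) : Finset (Equiv.Perm α) :=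
  Finset.univ.filter fun σ => nBad v (pr ρ0 σ) ≤ k

lemma Tk_large {v : α → β} {d : ℕ}
    (hv : ∀ b, (Finset.univ.filter (fun x => v x = b)).card ≤ d) {ρ0 : Equiv.Perm α}
    (hi : ∀ x, ρ0 (ρ0 x) = x) (hf : ∀ x, ρ0 x ≠ x) (hd : 0 < d)
    (hn : 2 * (4 * d + 2 * (d * d)) ≤ Fintype.card α) (hn0 : 0 < Fintype.card α) :
    (Fintype.card α).factorial ≤ 2 * (Tk v ρ0 (4 * (d + d * d))).card := by
  have h := double_count hv ρ0 Finset.univ Finset.univ (fun σ q r => Nice0 v (pr ρ0 σ) q r)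
    (4 * d + 2 * (d * d))
    (fun σ _ q r hb hn => ⟨Finset.mem_univ _, sw_rev (pr_invol hi σ) (pr_fpf hf σ) hn hb⟩)
    (fun σ _ q _ => card_not_nice hv _ q)
  rw [Finset.card_univ, Fintype.card_perm] at h
  set n := Fintype.card α
  set A := d + d * d
  have hA : 0 < A := by positivity
  have h3 : (4 * A) * (n.factorial - (Tk v ρ0 (4 * A)).card) ≤ ∑ σ, nBad v (pr ρ0 σ) := by
    have h4 := Finset.card_filter_add_card_filter_not (s := (Finset.univ : Finset (Equiv.Perm α)))
      (fun σ => nBad v (pr ρ0 σ) ≤ 4 * A)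
    rw [Finset.card_univ, Fintype.card_perm] at h4
    have h5 : n.factorial - (Tk v ρ0 (4 * A)).card =
      (Finset.univ.filter fun σ => ¬ nBad v (pr ρ0 σ) ≤ 4 * A).card := by
      change _ + _ = n.factorial at h4
      unfold Tk; omega
    rw [h5, mul_comm, ← smul_eq_mul]
    refine (Finset.card_nsmul_le_sum _ (fun σ => nBad v (pr ρ0 σ)) _ ?_).trans
      (Finset.sum_le_sum_of_subset (Finset.filter_subset _ _))
    intro σ hσ
    simp only [Finset.mem_filter, Finset.mem_univ, true_and] at hσ
    omega
  have h6 : (∑ σ, nBad v (pr ρ0 σ)) * n ≤ 2 * (n.factorial * (n * A)) := by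
    have : n ≤ 2 * (n - (4 * d + 2 * (d * d))) := by omega
    calc _ ≤ (∑ σ, nBad v (pr ρ0 σ)) * (2 * (n - (4 * d + 2 * (d * d)))) :=
          Nat.mul_le_mul_left _ this
      _ = 2 * ((∑ σ, nBad v (pr ρ0 σ)) * (n - (4 * d + 2 * (d * d)))) := by ring
      _ ≤ _ := Nat.mul_le_mul_left _ h
  have h7 : (∑ σ, nBad v (pr ρ0 σ)) ≤ 2 * (n.factorial * A) := by
    refine Nat.le_of_mul_le_mul_right (h6.trans (le_of_eq ?_)) hn0
    ring
  have h8 : (2 * (n.factorial - (Tk v ρ0 (4 * A)).card)) * (2 * A) ≤ n.factorial * (2 * A) := by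
    calc _ = (4 * A) * (n.factorial - (Tk v ρ0 (4 * A)).card) := by ring
      _ ≤ _ := h3.trans h7
      _ = _ := by ring
  have h9 := Nat.le_of_mul_le_mul_right h8 (by positivity)
  omega

lemma Tk_step {v : α → β} {d : ℕ}
    (hv : ∀ b, (Finset.univ.filter (fun x => v x = b)).card ≤ d) {ρ0 : Equiv.Perm α}
    (hi : ∀ x, ρ0 (ρ0 x) = x) (hf : ∀ x, ρ0 x ≠ x) (k : ℕ)
    (hn : 2 * (4 * d + 2 * (d * d) + (k + 1)) ≤ Fintype.card α) :
    (Tk v ρ0 (k + 1)).card ≤ (1 + 2 * (d + d * d)) * (Tk v ρ0 k).card := by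
  let S : Finset (Equiv.Perm α) := Finset.univ.filter fun σ => nBad v (pr ρ0 σ) = k + 1
  have h := double_count hv ρ0 S (Tk v ρ0 k)
    (fun σ q r => Nice0 v (pr ρ0 σ) q r ∧ ¬ Bad v (pr ρ0 σ) r)
    (4 * d + 2 * (d * d) + (k + 1))
    (fun σ hσ q r hb hn => by
      refine ⟨?_, sw_rev (pr_invol hi σ) (pr_fpf hf σ) hn.1 hb⟩
      have := nBad_sw (pr_invol hi σ) (pr_fpf hf σ) hn.1 hn.2 hb
      simp only [S, Finset.mem_filter, Finset.mem_univ, true_and] at hσ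
      simp only [Tk, Finset.mem_filter, Finset.mem_univ, true_and, pr_swap]
      omega)
    (fun σ hσ q _ => by
      simp only [S, Finset.mem_filter, Finset.mem_univ, true_and] at hσ
      rw [← hσ]
      refine le_trans ?_ (add_le_add (card_not_nice hv (pr ρ0 σ) q) le_rfl)
      refine le_trans (Finset.card_le_card ?_) (Finset.card_union_le _ _)
      intro r
      simp only [Finset.mem_filter, Finset.mem_univ, true_and, Finset.mem_union]
      intro h
      by_cases hB : Bad v (pr ρ0 σ) r
      · exact Or.inr hB
      · exact Or.inl fun hN => h ⟨hN, hB⟩)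
  set n := Fintype.card α
  set A := d + d * d
  have h1 : ∑ σ ∈ S, nBad v (pr ρ0 σ) ≥ S.card := by
    rw [Finset.card_eq_sum_ones]
    refine Finset.sum_le_sum fun σ hσ => ?_
    simp only [S, Finset.mem_filter, Finset.mem_univ, true_and] at hσ
    omega
  have h2 : S.card * n ≤ (2 * A * (Tk v ρ0 k).card) * n := by
    have : n ≤ 2 * (n - (4 * d + 2 * (d * d) + (k + 1))) := by omega
    calc _ ≤ (∑ σ ∈ S, nBad v (pr ρ0 σ)) * (2 * (n - (4 * d + 2 * (d * d) + (k + 1)))) :=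
          Nat.mul_le_mul h1 this
      _ = 2 * ((∑ σ ∈ S, nBad v (pr ρ0 σ)) * (n - (4 * d + 2 * (d * d) + (k + 1)))) := by ring
      _ ≤ 2 * ((Tk v ρ0 k).card * (n * A)) := Nat.mul_le_mul_left _ h
      _ = _ := by ring
  have h3 := Nat.le_of_mul_le_mul_right h2 (by omega)
  have h4 : Tk v ρ0 (k + 1) ⊆ Tk v ρ0 k ∪ S := by
    intro σ
    simp only [Tk, S, Finset.mem_filter, Finset.mem_univ, true_and, Finset.mem_union]
    omega
  have h5 := (Finset.card_le_card h4).trans (Finset.card_union_le _ _)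
  calc _ ≤ _ := h5
    _ ≤ (Tk v ρ0 k).card + 2 * A * (Tk v ρ0 k).card := by omega
    _ = _ := by ring

/-- The constant comparing all pairings with the simple ones. -/
def Qc (d : ℕ) : ℕ := 2 * (1 + 2 * (d + d * d)) ^ (4 * (d + d * d)) +
  (2 * (4 * d + 2 * (d * d) + 4 * (d + d * d))).factorial

lemma simple_fraction {v : α → β} {d : ℕ}
    (hv : ∀ b, (Finset.univ.filter (fun x => v x = b)).card ≤ d) {ρ0 : Equiv.Perm α}
    (hi : ∀ x, ρ0 (ρ0 x) = x) (hf : ∀ x, ρ0 x ≠ x) (hd : 0 < d)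
    (hne : (Tk v ρ0 0).Nonempty) :
    (Fintype.card α).factorial ≤ Qc d * (Tk v ρ0 0).card := by
  unfold Qc
  rw [add_mul]
  by_cases hn : 2 * (4 * d + 2 * (d * d) + 4 * (d + d * d)) ≤ Fintype.card α
  · refine le_trans ?_ (Nat.le_add_right _ _)
    have h1 := Tk_large hv hi hf hd (by omega) (by omega)
    have h2 : ∀ k, k ≤ 4 * (d + d * d) →
        (Tk v ρ0 k).card ≤ (1 + 2 * (d + d * d)) ^ k * (Tk v ρ0 0).card := by
      intro k
      induction k with
      | zero => intro _; simp
      | succ k ih =>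
        intro hk
        refine (Tk_step hv hi hf k (by omega)).trans ?_
        rw [pow_succ, mul_comm ((1 + 2 * (d + d * d)) ^ k), mul_assoc]
        exact Nat.mul_le_mul_left _ (ih (by omega))
    refine h1.trans ?_
    rw [mul_assoc]
    exact Nat.mul_le_mul_left _ (h2 _ le_rfl)
  · refine le_trans ?_ (Nat.le_add_left _ _)
    refine (Nat.factorial_le (by omega : Fintype.card α ≤
      2 * (4 * d + 2 * (d * d) + 4 * (d + d * d)))).trans ?_
    exact Nat.le_mul_of_pos_right _ hne.card_pos

end Switch


/-! ### From pairings to regular graphs -/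

lemma conj_fpf {α : Type*} [Fintype α] [DecidableEq α] {ρ0 ρ1 : Equiv.Perm α}
    (hi : ∀ x, ρ0 (ρ0 x) = x) (hf : ∀ x, ρ0 x ≠ x)
    (hi1 : ∀ x, ρ1 (ρ1 x) = x) (hf1 : ∀ x, ρ1 x ≠ x) : ∃ c : Equiv.Perm α, c * ρ0 * c⁻¹ = ρ1 := by
  have key : ∀ ρ : Equiv.Perm α, (∀ x, ρ (ρ x) = x) → (∀ x, ρ x ≠ x) →
      ∃ k, ρ.cycleType = Multiset.replicate k 2 ∧ k * 2 = Fintype.card α := by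
    intro ρ h1 h2
    have h3 : ρ ^ 2 = 1 := by ext x; simp [pow_two, h1]
    have : Fact (Nat.Prime 2) := ⟨Nat.prime_two⟩
    have h4 := Equiv.Perm.cycleType_of_pow_prime_eq_one h3
    refine ⟨_, h4, ?_⟩
    have h5 := Equiv.Perm.sum_cycleType ρ
    have h6 : ρ.support = Finset.univ := by ext x; simp [h2]
    rw [h4, h6, Multiset.sum_replicate] at h5
    simpa using h5
  obtain ⟨k, h1, h2⟩ := key ρ0 hi hf
  obtain ⟨k', h1', h2'⟩ := key ρ1 hi1 hf1
  have : k = k' := by omega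
  subst this
  exact isConj_iff.1 (Equiv.Perm.isConj_iff_cycleType_eq.2 (h1.trans h1'.symm))

lemma pr_fiber_card {α : Type*} [Fintype α] [DecidableEq α] {ρ0 ρ1 : Equiv.Perm α}
    (hi : ∀ x, ρ0 (ρ0 x) = x) (hf : ∀ x, ρ0 x ≠ x)
    (hi1 : ∀ x, ρ1 (ρ1 x) = x) (hf1 : ∀ x, ρ1 x ≠ x) :
    (Finset.univ.filter (fun σ => pr ρ0 σ = ρ1)).card =
      (Finset.univ.filter (fun σ => pr ρ0 σ = ρ0)).card := by
  obtain ⟨c, hc⟩ := conj_fpf hi hf hi1 hf1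
  refine (Finset.card_bij (fun σ _ => c * σ) ?_ ?_ ?_).symm
  · intro σ hσ
    have hσ' : σ * ρ0 * σ⁻¹ = ρ0 := (Finset.mem_filter.1 hσ).2
    refine Finset.mem_filter.2 ⟨Finset.mem_univ _, ?_⟩
    have : pr ρ0 (c * σ) = c * (σ * ρ0 * σ⁻¹) * c⁻¹ := by unfold pr; group
    rw [this, hσ', hc]
  · intro a _ b _ h
    exact mul_left_cancel h
  · intro τ hτ
    refine ⟨c⁻¹ * τ, ?_, by simp⟩
    have hτ' : τ * ρ0 * τ⁻¹ = ρ1 := (Finset.mem_filter.1 hτ).2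
    refine Finset.mem_filter.2 ⟨Finset.mem_univ _, ?_⟩
    have : pr ρ0 (c⁻¹ * τ) = c⁻¹ * (τ * ρ0 * τ⁻¹) * c := by unfold pr; group
    rw [this, hτ', ← hc]; group

section Fiber
variable {N d : ℕ}

/-- Labelling of half-edges at each vertex by neighbours. -/
abbrev Lab (d : ℕ) {N : ℕ} (a : Fin N → Fin N → Bool) : Type :=
  ∀ i, Fin d ≃ {j : Fin N // a i j = true}

/-- The pairing of a labelled graph. -/
def rlf {a : Fin N → Fin N → Bool} (ha : IsRegAdj d N a) (l : Lab d a) (p : Fin N × Fin d) :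
    Fin N × Fin d :=
  ((l p.1 p.2).1, (l (l p.1 p.2).1).symm ⟨p.1, by rw [ha.1]; exact (l p.1 p.2).2⟩)

lemma rlf_eq_iff {a : Fin N → Fin N → Bool} (ha : IsRegAdj d N a) (l : Lab d a)
    (p q : Fin N × Fin d) :
    rlf ha l p = q ↔ (l p.1 p.2).1 = q.1 ∧ (l q.1 q.2).1 = p.1 := by
  rcases q with ⟨j, k'⟩
  constructor
  · intro h
    simp only [rlf, Prod.mk.injEq] at h
    obtain ⟨h1, h2⟩ := h
    subst h1
    refine ⟨rfl, ?_⟩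
    rw [← h2]; simp
  · rintro ⟨h1, h2⟩
    simp only at h1 h2
    subst h1
    simp only [rlf, Prod.mk.injEq, true_and]
    rw [Equiv.symm_apply_eq]
    exact Subtype.ext h2.symm

lemma rlf_invol {a : Fin N → Fin N → Bool} (ha : IsRegAdj d N a) (l : Lab d a) :
    Function.Involutive (rlf ha l) := by
  intro p
  rw [rlf_eq_iff]
  exact ((rlf_eq_iff ha l p _).1 rfl).symm

/-- The pairing of a labelled graph, as a permutation. -/
def rl {a : Fin N → Fin N → Bool} (ha : IsRegAdj d N a) (l : Lab d a) :
    Equiv.Perm (Fin N × Fin d) := (rlf_invol ha l).toPerm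

lemma rl_fst {a : Fin N → Fin N → Bool} (ha : IsRegAdj d N a) (l : Lab d a) (p) :
    (rl ha l p).1 = (l p.1 p.2).1 := rfl

lemma rl_fpf {a : Fin N → Fin N → Bool} (ha : IsRegAdj d N a) (l : Lab d a) (p) :
    rl ha l p ≠ p := by
  intro h
  have h1 : (l p.1 p.2).1 = p.1 := by rw [← rl_fst ha, h]
  have h2 := (l p.1 p.2).2
  rw [h1, ha.2.1] at h2
  exact absurd h2 (by simp)

lemma rl_inj {a : Fin N → Fin N → Bool} (ha : IsRegAdj d N a) {l l' : Lab d a}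
    (h : rl ha l = rl ha l') : l = l' := by
  funext i
  ext k
  have := congrArg (fun ρ : Equiv.Perm (Fin N × Fin d) => ((ρ (i, k)).1 : ℕ)) h
  simpa [rl_fst] using this

/-- The graph of a pairing. -/
def gr (ρ : Equiv.Perm (Fin N × Fin d)) (i j : Fin N) : Bool :=
  decide (∃ k, (ρ (i, k)).1 = j)

lemma gr_reg {ρ : Equiv.Perm (Fin N × Fin d)} (hi : ∀ x, ρ (ρ x) = x)
    (hb : ∀ q, ¬ Bad Prod.fst ρ q) : IsRegAdj d N (gr ρ) := by
  have key : ∀ i j, gr ρ i j = true → gr ρ j i = true := by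
    intro i j h
    simp only [gr, decide_eq_true_eq] at h ⊢
    obtain ⟨k, hk⟩ := h
    refine ⟨(ρ (i,k)).2, ?_⟩
    have : (j, (ρ (i,k)).2) = ρ (i,k) := by rw [← hk]
    rw [this, hi]
  refine ⟨fun i j => ?_, fun i => ?_, fun i => ?_⟩
  · rw [Bool.eq_iff_iff]; exact ⟨key i j, key j i⟩
  · simp only [gr, decide_eq_false_iff_not]
    rintro ⟨k, hk⟩
    exact hb (i,k) (Or.inl hk)
  · have : (Finset.univ.filter (fun j => gr ρ i j = true)) =
        Finset.univ.image (fun k => (ρ (i,k)).1) := by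
      ext j; simp [gr]
    rw [this, Finset.card_image_of_injective]
    · simp
    · intro k k' h
      by_contra hne
      exact hb (i,k) (Or.inr ⟨(i,k'), by simpa using fun h => hne h.symm, rfl, h.symm⟩)

lemma fib_iff {a : Fin N → Fin N → Bool} (ha : IsRegAdj d N a) {ρ : Equiv.Perm (Fin N × Fin d)}
    (hi : ∀ x, ρ (ρ x) = x) :
    ((∀ q, ¬ Bad Prod.fst ρ q) ∧ gr ρ = a) ↔ ∃ l : Lab d a, ρ = rl ha l := by
  constructor
  · rintro ⟨hb, rfl⟩
    have hbij : ∀ i, Function.Bijective (fun k : Fin d =>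
        (⟨(ρ (i,k)).1, by simp [gr]⟩ : {j // gr ρ i j = true})) := by
      intro i
      constructor
      · intro k k' h
        by_contra hne
        simp only [Subtype.mk.injEq] at h
        exact hb (i,k) (Or.inr ⟨(i,k'), by simpa using fun h => hne h.symm, rfl, h.symm⟩)
      · rintro ⟨j, hj⟩
        have hj' := hj
        simp only [gr, decide_eq_true_eq] at hj'
        obtain ⟨k, hk⟩ := hj'
        exact ⟨k, Subtype.ext hk⟩
    set l0 : Lab d (gr ρ) := fun i => Equiv.ofBijective _ (hbij i) with hl0
    have hl : ∀ p, (l0 p.1 p.2).1 = (ρ p).1 := fun p => rfl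
    refine ⟨l0, ?_⟩
    ext1 p
    symm
    refine (rlf_eq_iff ha l0 p (ρ p)).2 ⟨hl p, ?_⟩
    rw [hl, hi]
  · rintro ⟨l, rfl⟩
    refine ⟨?_, ?_⟩
    · rintro q (h | ⟨q2, h1, h2, h3⟩)
      · rw [rl_fst] at h
        have h2 := (l q.1 q.2).2
        rw [h, ha.2.1] at h2
        exact absurd h2 (by simp)
      · rcases q with ⟨i, k⟩
        rcases q2 with ⟨i', k'⟩
        simp only at h2
        subst h2
        rw [rl_fst, rl_fst] at h3
        have := (l i').injective (Subtype.ext h3)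
        simp only at this
        exact h1 (by rw [this])
    · funext i j
      rw [Bool.eq_iff_iff]
      unfold gr
      rw [decide_eq_true_eq]
      simp only [rl_fst]
      constructor
      · rintro ⟨k, rfl⟩; exact (l i k).2
      · intro h
        exact ⟨(l i).symm ⟨j, h⟩, by simp⟩

lemma card_Lab {a : Fin N → Fin N → Bool} (ha : IsRegAdj d N a) :
    Fintype.card (Lab d a) = d.factorial ^ N := by
  rw [Fintype.card_pi]
  rw [Finset.prod_congr rfl (g := fun _ => d.factorial)]
  · simp
  · intro i _
    have h : Fintype.card (Fin d) = Fintype.card {j : Fin N // a i j = true} := by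
      rw [Fintype.card_subtype]; simp only [Fintype.card_fin]; exact (ha.2.2 i).symm
    rw [Fintype.card_equiv (Fintype.equivOfCardEq h)]
    simp

lemma fib_card {ρ0 : Equiv.Perm (Fin N × Fin d)}
    (hi : ∀ x, ρ0 (ρ0 x) = x) (hf : ∀ x, ρ0 x ≠ x)
    {a : Fin N → Fin N → Bool} (ha : IsRegAdj d N a) :
    ((Tk Prod.fst ρ0 0).filter (fun σ => gr (pr ρ0 σ) = a)).card =
      d.factorial ^ N * (Finset.univ.filter (fun σ => pr ρ0 σ = ρ0)).card := by
  have h1 : ((Tk Prod.fst ρ0 0).filter (fun σ => gr (pr ρ0 σ) = a)) =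
      (Finset.univ : Finset (Lab d a)).biUnion
        (fun l => Finset.univ.filter (fun σ => pr ρ0 σ = rl ha l)) := by
    ext σ
    have := fib_iff ha (pr_invol hi σ)
    simp only [Finset.mem_filter, Finset.mem_biUnion, Finset.mem_univ, true_and, ← this]
    simp [Tk, nBad, Finset.filter_eq_empty_iff]
  rw [h1, Finset.card_biUnion]
  · rw [Finset.sum_congr rfl (fun l _ => pr_fiber_card (ρ1 := rl ha l) hi hf (rlf_invol ha l) (rl_fpf ha l))]
    rw [Finset.sum_const, Finset.card_univ, card_Lab ha, smul_eq_mul]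
  · intro l _ l' _ hne
    refine Finset.disjoint_left.2 ?_
    intro σ h hb
    simp only [Finset.mem_filter, Finset.mem_univ, true_and] at h hb
    exact hne (rl_inj ha (h.symm.trans hb))

/-- Summation over simple pairings is a multiple of summation over regular graphs. -/
lemma sum_T0 {ρ0 : Equiv.Perm (Fin N × Fin d)}
    (hi : ∀ x, ρ0 (ρ0 x) = x) (hf : ∀ x, ρ0 x ≠ x) :
    ∃ w : ℕ, 0 < w ∧ ∀ φ : (Fin N → Fin N → Bool) → ℝ,
      ∑ σ ∈ Tk Prod.fst ρ0 0, φ (gr (pr ρ0 σ)) =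
        w * ∑ a ∈ Finset.univ.filter (fun a => IsRegAdj d N a), φ a := by
  refine ⟨d.factorial ^ N * (Finset.univ.filter (fun σ => pr ρ0 σ = ρ0)).card, ?_, fun φ => ?_⟩
  · apply Nat.mul_pos (pow_pos (Nat.factorial_pos _) _)
    rw [Finset.card_pos]
    exact ⟨1, Finset.mem_filter.2 ⟨Finset.mem_univ _, by simp [pr]⟩⟩
  · have hmap : ∀ σ ∈ Tk Prod.fst ρ0 0, gr (pr ρ0 σ) ∈
        Finset.univ.filter (fun a => IsRegAdj d N a) := by
      intro σ hσ
      simp only [Finset.mem_filter, Finset.mem_univ, true_and]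
      apply gr_reg (pr_invol hi σ)
      simpa [Tk, nBad, Finset.filter_eq_empty_iff] using hσ
    rw [← Finset.sum_fiberwise_of_maps_to hmap, Finset.mul_sum]
    refine Finset.sum_congr rfl fun a ha => ?_
    simp only [Finset.mem_filter, Finset.mem_univ, true_and] at ha
    rw [Finset.sum_congr rfl (g := fun _ => φ a)]
    · rw [Finset.sum_const, fib_card hi hf ha, nsmul_eq_mul]
    · intro σ hσ
      rw [(Finset.mem_filter.1 hσ).2]

/-- Edge-count matrix of the pairing attached to `σ`. -/
def Mp (ρ0 σ : Equiv.Perm (Fin N × Fin d)) (i j : Fin N) : ℝ :=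
  ∑ x, if (σ x).1 = i ∧ (σ (ρ0 x)).1 = j then 1 else 0

lemma Mp_symm {ρ0 : Equiv.Perm (Fin N × Fin d)} (hi : ∀ x, ρ0 (ρ0 x) = x)
    (σ : Equiv.Perm (Fin N × Fin d)) : Matrix.transpose (Mp ρ0 σ) = Mp ρ0 σ := by
  ext i j
  simp only [Matrix.transpose_apply, Mp]
  rw [← Equiv.sum_comp ρ0]
  refine Finset.sum_congr rfl fun x _ => ?_
  rw [hi]
  simp [and_comm]

lemma Mp_simple {ρ0 : Equiv.Perm (Fin N × Fin d)}
    {σ : Equiv.Perm (Fin N × Fin d)} (hσ : σ ∈ Tk Prod.fst ρ0 0) :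
    Mp ρ0 σ = fun i j => if gr (pr ρ0 σ) i j then 1 else 0 := by
  have hb : ∀ q, ¬ Bad Prod.fst (pr ρ0 σ) q := by
    simpa [Tk, nBad, Finset.filter_eq_empty_iff] using hσ
  funext i j
  have h1 : Mp ρ0 σ i j = ∑ y, if y.1 = i ∧ (pr ρ0 σ y).1 = j then (1:ℝ) else 0 := by
    rw [← Equiv.sum_comp σ]
    simp [Mp, pr]
  rw [h1]
  by_cases h : gr (pr ρ0 σ) i j = true
  · rw [if_pos h]
    simp only [gr, decide_eq_true_eq] at h
    obtain ⟨k, hk⟩ := h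
    rw [Finset.sum_eq_single (i,k)]
    · simp [hk]
    · intro y _ hy
      rw [if_neg]
      rintro ⟨h2, h3⟩
      exact hb (i,k) (Or.inr ⟨y, hy, h2, h3.trans hk.symm⟩)
    · simp
  · rw [if_neg h]
    apply Finset.sum_eq_zero
    intro y _
    rw [if_neg]
    rintro ⟨h2, h3⟩
    apply h
    simp only [gr, decide_eq_true_eq]
    exact ⟨y.2, by rw [← h2]; exact h3⟩

lemma Mp_swap (ρ0 σ : Equiv.Perm (Fin N × Fin d)) 
    (b c : Fin N × Fin d) :
    ∑ i, ∑ j, |Mp ρ0 (Equiv.swap b c * σ) i j - Mp ρ0 σ i j| ≤ 8 := by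
  -- positions where the two sums differ
  set S : Finset (Fin N × Fin d) :=
    {σ⁻¹ b, σ⁻¹ c, ρ0⁻¹ (σ⁻¹ b), ρ0⁻¹ (σ⁻¹ c)} with hS
  have hcard : S.card ≤ 4 := Finset.card_le_four
  set e : Equiv.Perm (Fin N × Fin d) → (Fin N × Fin d) → Fin N → Fin N → ℝ := fun τ x i j =>
    if (τ x).1 = i ∧ (τ (ρ0 x)).1 = j then 1 else 0 with he
  have hsum : ∀ τ x, ∑ i, ∑ j, |e τ x i j| = 1 := by
    intro τ x
    rw [Finset.sum_eq_single (τ x).1, Finset.sum_eq_single (τ (ρ0 x)).1]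
    · simp [he]
    · intro j _ hj; simp [he, hj.symm]
    · simp
    · intro i _ hi'
      apply Finset.sum_eq_zero
      intro j _; simp [he, hi'.symm]
    · simp
  have hout : ∀ x, x ∉ S → ∀ i j, e (Equiv.swap b c * σ) x i j = e σ x i j := by
    intro x hx i j
    simp only [hS, Finset.mem_insert, Finset.mem_singleton, not_or] at hx
    obtain ⟨h1, h2, h3, h4⟩ := hx
    have e1 : σ x ≠ b := fun h => h1 (by simp [← h])
    have e2 : σ x ≠ c := fun h => h2 (by simp [← h])
    have e3 : σ (ρ0 x) ≠ b := fun h => h3 (by simp [← h])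
    have e4 : σ (ρ0 x) ≠ c := fun h => h4 (by simp [← h])
    simp [he, Equiv.swap_apply_of_ne_of_ne e1 e2, Equiv.swap_apply_of_ne_of_ne e3 e4]
  have hM : ∀ i j, Mp ρ0 (Equiv.swap b c * σ) i j - Mp ρ0 σ i j =
      ∑ x ∈ S, (e (Equiv.swap b c * σ) x i j - e σ x i j) := by
    intro i j
    have : Mp ρ0 (Equiv.swap b c * σ) i j - Mp ρ0 σ i j =
        ∑ x, (e (Equiv.swap b c * σ) x i j - e σ x i j) := by
      rw [Finset.sum_sub_distrib]; rfl
    rw [this]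
    symm
    apply Finset.sum_subset (Finset.subset_univ _)
    intro x _ hx
    rw [hout x hx, sub_self]
  calc ∑ i, ∑ j, |Mp ρ0 (Equiv.swap b c * σ) i j - Mp ρ0 σ i j|
      ≤ ∑ i, ∑ j, ∑ x ∈ S, (|e (Equiv.swap b c * σ) x i j| + |e σ x i j|) := by
        refine Finset.sum_le_sum fun i _ => Finset.sum_le_sum fun j _ => ?_
        rw [hM]
        exact (Finset.abs_sum_le_sum_abs _ _).trans (Finset.sum_le_sum fun x _ => abs_sub _ _)
    _ = ∑ x ∈ S, ∑ i, ∑ j, (|e (Equiv.swap b c * σ) x i j| + |e σ x i j|) := by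
        rw [Finset.sum_congr rfl fun i _ => Finset.sum_comm]
        exact Finset.sum_comm
    _ = ∑ x ∈ S, (2:ℝ) := by
        refine Finset.sum_congr rfl fun x _ => ?_
        simp only [Finset.sum_add_distrib, hsum]; norm_num
    _ ≤ 8 := by
        rw [Finset.sum_const, nsmul_eq_mul]
        have : (S.card : ℝ) ≤ 4 := by exact_mod_cast hcard
        linarith

end Fiber

/-! ### Concentration for the random regular graph -/

section Graph
variable {N d : ℕ}

lemma graph_mgf1 (hd : 0 < d) {a0 : Fin N → Fin N → Bool} (ha0 : IsRegAdj d N a0)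
    {H : Matrix (Fin N) (Fin N) ℝ → ℝ} {κ : ℝ} (hκ : 0 ≤ κ)
    (hH : ∀ M M' : Matrix (Fin N) (Fin N) ℝ, Matrix.transpose M = M → Matrix.transpose M' = M' →
      |H M - H M'| ≤ κ * ∑ i, ∑ j, |M i j - M' i j|) :
    ∃ m : ℝ, ∀ l : ℝ, ∑ a ∈ Finset.univ.filter (fun a => IsRegAdj d N a),
        Real.exp (l * (H (fun i j => if a i j then 1 else 0) - m)) ≤
      ((Finset.univ.filter (fun a => IsRegAdj d N a)).card : ℝ) *
        (Qc d * Real.exp (l ^ 2 * (2 * (N * d) * (κ * 8) ^ 2))) := by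
  have hLab : Nonempty (Lab d a0) := by
    rw [← Fintype.card_pos_iff, card_Lab ha0]
    exact pow_pos (Nat.factorial_pos _) _
  obtain ⟨l0⟩ := hLab
  set ρ0 := rl ha0 l0 with hρ0
  have hi : ∀ x, ρ0 (ρ0 x) = x := rlf_invol ha0 l0
  have hf : ∀ x, ρ0 x ≠ x := rl_fpf ha0 l0
  obtain ⟨w, hw, hsum⟩ := sum_T0 hi hf
  set R := Finset.univ.filter (fun a => IsRegAdj d N a) with hR
  have hRne : a0 ∈ R := by simp [hR, ha0]
  have hcardT : ((Tk Prod.fst ρ0 0).card : ℝ) = w * R.card := by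
    have := hsum (fun _ => 1)
    simpa using this
  have hTne : (Tk Prod.fst ρ0 0).Nonempty := by
    rw [← Finset.card_pos]
    have h1 : (0:ℝ) < R.card := by exact_mod_cast Finset.card_pos.2 ⟨a0, hRne⟩
    have h2 : (0:ℝ) < w := by exact_mod_cast hw
    have : (0:ℝ) < (Tk Prod.fst ρ0 0).card := by rw [hcardT]; positivity
    exact_mod_cast this
  have hv : ∀ b : Fin N,
      (Finset.univ.filter (fun x : Fin N × Fin d => Prod.fst x = b)).card ≤ d := by
    intro b
    have : (Finset.univ.filter (fun x : Fin N × Fin d => Prod.fst x = b)) ⊆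
        Finset.univ.image (fun k : Fin d => (b, k)) := by
      rintro ⟨i, k⟩ h
      simp only [Finset.mem_filter, Finset.mem_univ, true_and] at h
      simp [h]
    exact (Finset.card_le_card this).trans (Finset.card_image_le.trans (by simp))
  have hsf := simple_fraction hv hi hf hd hTne
  have hcα : Fintype.card (Fin N × Fin d) = N * d := by simp
  set f : Equiv.Perm (Fin N × Fin d) → ℝ := fun σ => H (Mp ρ0 σ) with hfdef
  have hlip : ∀ σ a b, |f (Equiv.swap a b * σ) - f σ| ≤ κ * 8 := by
    intro σ a b
    refine (hH _ _ (Mp_symm hi _) (Mp_symm hi _)).trans ?_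
    exact mul_le_mul_of_nonneg_left (Mp_swap ρ0 σ a b) hκ
  refine ⟨(∑ τ, f τ) / (Fintype.card (Fin N × Fin d)).factorial, fun l => ?_⟩
  have hpc := perm_conc' f hlip l
  set m := (∑ τ, f τ) / (Fintype.card (Fin N × Fin d)).factorial with hm
  have h1 : ∑ σ ∈ Tk Prod.fst ρ0 0, Real.exp (l * (f σ - m)) ≤
      ∑ σ, Real.exp (l * (f σ - m)) :=
    Finset.sum_le_sum_of_subset_of_nonneg (Finset.subset_univ _) (fun _ _ _ => (Real.exp_pos _).le)
  have h2 : ∑ σ ∈ Tk Prod.fst ρ0 0, Real.exp (l * (f σ - m)) =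
      w * ∑ a ∈ R, Real.exp (l * (H (fun i j => if a i j then 1 else 0) - m)) := by
    rw [← hsum (fun a => Real.exp (l * (H (fun i j => if a i j then 1 else 0) - m)))]
    refine Finset.sum_congr rfl fun σ hσ => ?_
    simp only [hfdef]
    rw [Mp_simple hσ]
  have h3 : ((Fintype.card (Fin N × Fin d)).factorial : ℝ) ≤ Qc d * (w * R.card) := by
    rw [← hcardT]; exact_mod_cast hsf
  have h4 : w * ∑ a ∈ R, Real.exp (l * (H (fun i j => if a i j then 1 else 0) - m)) ≤
      w * (R.card * (Qc d * Real.exp (l ^ 2 * (2 * (N * d) * (κ * 8) ^ 2)))) := by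
    rw [← h2]
    refine h1.trans (hpc.trans ((mul_le_mul_of_nonneg_right h3 (Real.exp_pos _).le).trans
      (le_of_eq ?_)))
    rw [hcα]
    push_cast
    rw [show (N * d * (2 * (l ^ 2 * (κ * 8) ^ 2)) : ℝ) = l ^ 2 * (2 * (N * d) * (κ * 8) ^ 2) by ring]
    ring
  exact le_of_mul_le_mul_left h4 (by exact_mod_cast hw)

lemma unif_int (φ : (Fin N → Fin N → Bool) → ℝ) :
    ∫ a, φ a ∂(uniformOn {a | IsRegAdj d N a}) =
      (∑ a ∈ Finset.univ.filter (fun a => IsRegAdj d N a), φ a) /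
        (Finset.univ.filter (fun a => IsRegAdj d N a)).card := by
  set R := Finset.univ.filter (fun a => IsRegAdj d N a) with hR
  have hS : {a | IsRegAdj d N a} = (R : Set (Fin N → Fin N → Bool)) := by
    ext a; simp [hR]
  rw [hS, integral_fintype (Integrable.of_finite), Finset.sum_div,
    ← Finset.sum_subset (Finset.subset_univ R)]
  · refine Finset.sum_congr rfl fun a ha => ?_
    have : (uniformOn (R : Set (Fin N → Fin N → Bool))).real {a} = 1 / R.card := by
      rw [measureReal_def, ← Finset.coe_singleton, uniformOn_apply_finset,
        Finset.inter_singleton_of_mem ha]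
      simp
    rw [this, smul_eq_mul]; ring
  · intro a _ ha
    have : (uniformOn (R : Set (Fin N → Fin N → Bool))).real {a} = 0 := by
      rw [measureReal_def, ← Finset.coe_singleton, uniformOn_apply_finset,
        Finset.inter_singleton_of_notMem ha]
      simp
    rw [this, zero_smul]

lemma unif_prob {a0 : Fin N → Fin N → Bool} (ha0 : IsRegAdj d N a0) :
    IsProbabilityMeasure (uniformOn {a | IsRegAdj d N a}) :=
  isProbabilityMeasure_uniformOn (Set.toFinite _) ⟨a0, ha0⟩

lemma graph_mgf2 (hd : 0 < d) {a0 : Fin N → Fin N → Bool} (ha0 : IsRegAdj d N a0)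
    {H : Matrix (Fin N) (Fin N) ℝ → ℝ} {κ : ℝ} (hκ : 0 ≤ κ)
    (hH : ∀ M M' : Matrix (Fin N) (Fin N) ℝ, Matrix.transpose M = M → Matrix.transpose M' = M' →
      |H M - H M'| ≤ κ * ∑ i, ∑ j, |M i j - M' i j|)
    {h : (Fin N → Fin N → Bool) → ℝ}
    (hh : ∀ a, IsRegAdj d N a → h a = H (fun i j => if a i j then 1 else 0)) (l : ℝ) :
    ∫ a, Real.exp (l * (h a - ∫ b, h b ∂(uniformOn {a | IsRegAdj d N a})))
        ∂(uniformOn {a | IsRegAdj d N a}) ≤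
      (Qc d : ℝ) ^ 2 * Real.exp (l ^ 2 * (4 * (N * d) * (κ * 8) ^ 2)) := by
  have := unif_prob ha0
  obtain ⟨m, hm⟩ := graph_mgf1 hd ha0 hκ hH
  have hm' : ∀ l, ∫ a, Real.exp (l * (h a - m)) ∂(uniformOn {a | IsRegAdj d N a}) ≤
      Qc d * Real.exp (l ^ 2 * (2 * (N * d) * (κ * 8) ^ 2)) := by
    intro l
    rw [unif_int]
    have hpos : (0:ℝ) < (Finset.univ.filter (fun a => IsRegAdj d N a)).card := by
      exact_mod_cast Finset.card_pos.2 ⟨a0, by simp [ha0]⟩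
    rw [div_le_iff₀ hpos, mul_comm]
    refine le_trans (le_of_eq ?_) (hm l)
    refine Finset.sum_congr rfl fun a ha => ?_
    rw [hh a (Finset.mem_filter.1 ha).2]
  set μ := uniformOn {a | IsRegAdj d N a} with hμ
  set m1 := ∫ b, h b ∂μ with hm1
  have hJ : Real.exp (l * (m - m1)) ≤ Qc d * Real.exp (l ^ 2 * (2 * (N * d) * (κ * 8) ^ 2)) := by
    have h1 := convexOn_exp.map_integral_le (μ := μ) (f := fun a => (-l) * (h a - m))
      Real.continuous_exp.continuousOn isClosed_univ (Eventually.of_forall fun _ => Set.mem_univ _)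
      Integrable.of_finite Integrable.of_finite
    have h2 : ∫ a, (-l) * (h a - m) ∂μ = l * (m - m1) := by
      rw [integral_const_mul, integral_sub Integrable.of_finite Integrable.of_finite]
      simp; ring
    rw [h2] at h1
    refine h1.trans ?_
    have := hm' (-l)
    rw [neg_sq] at this
    exact this
  have h3 : ∫ a, Real.exp (l * (h a - m1)) ∂μ =
      Real.exp (l * (m - m1)) * ∫ a, Real.exp (l * (h a - m)) ∂μ := by
    rw [← integral_const_mul]
    congr 1; funext a
    rw [← Real.exp_add]; congr 1; ring
  rw [h3]
  refine (mul_le_mul hJ (hm' l) (integral_nonneg fun _ => (Real.exp_pos _).le)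
    (by positivity)).trans (le_of_eq ?_)
  rw [show l ^ 2 * (4 * (N * d) * (κ * 8) ^ 2) = l ^ 2 * (2 * (N * d) * (κ * 8) ^ 2) +
    l ^ 2 * (2 * (N * d) * (κ * 8) ^ 2) by ring, Real.exp_add]
  ring

lemma graph_tail (hd : 0 < d) (hN : 0 < N) {a0 : Fin N → Fin N → Bool} (ha0 : IsRegAdj d N a0)
    {H : Matrix (Fin N) (Fin N) ℝ → ℝ} {κ : ℝ} (hκ : 0 < κ)
    (hH : ∀ M M' : Matrix (Fin N) (Fin N) ℝ, Matrix.transpose M = M → Matrix.transpose M' = M' →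
      |H M - H M'| ≤ κ * ∑ i, ∑ j, |M i j - M' i j|)
    {h : (Fin N → Fin N → Bool) → ℝ}
    (hh : ∀ a, IsRegAdj d N a → h a = H (fun i j => if a i j then 1 else 0)) {r : ℝ}
    (hr : 0 ≤ r) :
    uniformOn {a | IsRegAdj d N a} {a | r ≤ |h a - ∫ b, h b ∂(uniformOn {a | IsRegAdj d N a})|} ≤
      ENNReal.ofReal (2 * (Qc d : ℝ) ^ 2 *
        Real.exp (-r ^ 2 / (4 * (4 * (N * d) * (κ * 8) ^ 2)))) := by
  have := unif_prob ha0
  have hN' : (0:ℝ) < N := by exact_mod_cast hN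
  have hd' : (0:ℝ) < d := by exact_mod_cast hd
  exact tail_of_mgf (X := h) (B := ∑ a, |h a|) Measurable.of_discrete
    (fun a => Finset.single_le_sum (f := fun a => |h a|) (fun _ _ => abs_nonneg _)
      (Finset.mem_univ a)) (by positivity)
    (graph_mgf2 hd ha0 hκ.le hH hh) hr

end Graph

/-! ### Assembly -/

lemma absorb {A K y c0 : ℝ} (hA : 0 ≤ A) (hK : 0 ≤ K) (hc0 : 0 < c0) {p : ℝ≥0∞}
    (hp1 : p ≤ 1) (hp : p ≤ ENNReal.ofReal A + ENNReal.ofReal (2 * K * Real.exp (-y / c0))) :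
    p ≤ ENNReal.ofReal (A + 2 * Real.exp (-y / (c0 * (1 + 2 * K)))) := by
  have hC : 0 < c0 * (1 + 2 * K) := by positivity
  by_cases h : 1 / 2 ≤ Real.exp (-y / (c0 * (1 + 2 * K)))
  · refine hp1.trans ?_
    rw [← ENNReal.ofReal_one]
    apply ENNReal.ofReal_le_ofReal
    linarith
  · push Not at h
    refine hp.trans ?_
    rw [← ENNReal.ofReal_add hA (by positivity)]
    apply ENNReal.ofReal_le_ofReal
    have h1 : -y / (c0 * (1 + 2 * K)) < -Real.log 2 := by
      have := (Real.lt_log_iff_exp_lt (by norm_num : (0:ℝ) < 1 / 2)).2 h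
      rwa [one_div, Real.log_inv] at this
    have h2 := Real.log_two_gt_d9
    set w := -y / (c0 * (1 + 2 * K)) with hw
    have h3 : -y / c0 = (1 + 2 * K) * w := by rw [hw]; field_simp
    have h4 : K * Real.exp (-y / c0) ≤ Real.exp w := by
      calc K * Real.exp (-y / c0) ≤ Real.exp K * Real.exp (-y / c0) := by
            apply mul_le_mul_of_nonneg_right _ (Real.exp_pos _).le
            linarith [Real.add_one_le_exp K]
        _ = Real.exp (K + (1 + 2 * K) * w) := by rw [← Real.exp_add, h3]
        _ ≤ Real.exp w := by
            apply Real.exp_le_exp.2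
            nlinarith
    linarith

lemma rpow_id {η s : ℝ} (hη : 0 < η) : ((1 / η) ^ (s + 1)) ^ 2 * η ^ (2 * s + 2) = 1 := by
  have h1 : η ^ (2 * s + 2) = (η ^ (s + 1)) ^ 2 := by
    rw [← Real.rpow_natCast, ← Real.rpow_mul hη.le]; congr 1; push_cast; ring
  rw [h1, ← mul_pow, ← Real.mul_rpow (by positivity) hη.le, one_div_mul_cancel hη.ne']
  simp

/-- The 0-1 adjacency matrix. -/
def ind {N : ℕ} (a : Fin N → Fin N → Bool) : Matrix (Fin N) (Fin N) ℝ :=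
  fun i j => if a i j then 1 else 0

lemma ind_symm {N d : ℕ} {a : Fin N → Fin N → Bool} (ha : IsRegAdj d N a) :
    Matrix.transpose (ind a) = ind a := by
  ext i j
  simp [ind, ha.1 j i]

lemma Wmat_eq {N : ℕ} (t : ℝ) (a : Fin N → Fin N → Bool) (v : Fin N → ℝ) :
    Wmat t a v = Wgen t (ind a) v := by
  ext i j
  simp [Wmat, Wgen, ind]

lemma Ftil_eq {N : ℕ} (t s : ℝ) (z : ℂ) (ω : (Fin N → Fin N → Bool) × (Fin N → ℝ)) :
    Ftil t s z ω = Fm s z (Wgen t (ind ω.1) ω.2) := by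
  simp only [Ftil, Fm, imG, Wmat_eq]

lemma Fm_meas {N : ℕ} {s : ℝ} (hs : 1 ≤ s) {z : ℂ} (hz : 0 < z.im) (t : ℝ)
    {M : Matrix (Fin N) (Fin N) ℝ} (hM : Mᵀ = M) :
    Measurable (fun v => Fm s z (Wgen t M v)) := by
  have hc : 0 ≤ s * (1 / z.im) ^ (s + 1) / N := by positivity
  have : LipschitzWith (Real.toNNReal ((s * (1 / z.im) ^ (s + 1) / N) * N))
      (fun v => Fm s z (Wgen t M v)) := by
    apply LipschitzWith.of_dist_le_mul
    intro v v'
    rw [Real.dist_eq, Real.coe_toNNReal _ (by positivity)]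
    refine (Fm_lip_v hs hz t hM v v').trans ?_
    rw [mul_assoc]
    apply mul_le_mul_of_nonneg_left _ hc
    calc ∑ k, |v k - v' k| ≤ ∑ k : Fin N, dist v v' := by
          refine Finset.sum_le_sum fun k _ => ?_
          rw [← Real.dist_eq]; exact dist_le_pi_dist v v' k
      _ = N * dist v v' := by simp
  exact this.continuous.measurable

lemma Fm_mean_lip {N : ℕ} {s : ℝ} (hs : 1 ≤ s) {z : ℂ} (hz : 0 < z.im) {t : ℝ} (ht : 0 < t)
    (M M' : Matrix (Fin N) (Fin N) ℝ) (hM : Matrix.transpose M = M)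
    (hM' : Matrix.transpose M' = M') :
    |∫ v, Fm s z (Wgen t M v) ∂(Measure.pi fun _ => gaussianReal 0 1) -
      ∫ v, Fm s z (Wgen t M' v) ∂(Measure.pi fun _ => gaussianReal 0 1)| ≤
      (s * (1 / z.im) ^ (s + 1) / N) * t * ∑ i, ∑ j, |M i j - M' i j| := by
  rw [← integral_sub
    (integrable_of_abs_le (Fm_meas hs hz t hM) fun v => Fm_abs_le hs hz (Wgen_symm t hM v))
    (integrable_of_abs_le (Fm_meas hs hz t hM') fun v => Fm_abs_le hs hz (Wgen_symm t hM' v))]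
  apply abs_integral_le_of_abs_le
  intro v
  rw [mul_assoc]
  exact Fm_lip_M hs hz ht hM hM' v

lemma main_bound {N d : ℕ} (hd : 0 < d) (hN : 0 < N) {a0 : Fin N → Fin N → Bool}
    (ha0 : IsRegAdj d N a0) {s : ℝ} (hs : 1 ≤ s) {z : ℂ} (hz : 0 < z.im) {t : ℝ} (ht : 0 < t)
    {u r1 r2 : ℝ} (hr1 : 0 < r1) (hr2 : 0 ≤ r2) (hu : r1 + r2 ≤ u) :
    graphMeasure d N {ω | u ≤ |Ftil t s z ω - ∫ ω', Ftil t s z ω' ∂(graphMeasure d N)|} ≤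
      ENNReal.ofReal (2 * 1 *
        Real.exp (-r1 ^ 2 / (4 * (N * (s * (1 / z.im) ^ (s + 1) / N) ^ 2)))) +
      ENNReal.ofReal (2 * (Qc d : ℝ) ^ 2 * Real.exp (-r2 ^ 2 /
        (4 * (4 * (N * d) * ((s * (1 / z.im) ^ (s + 1) / N) * t * 8) ^ 2)))) := by
  have hprob := unif_prob ha0
  have hN' : (0:ℝ) < N := by exact_mod_cast hN
  have hL : 0 < s * (1 / z.im) ^ (s + 1) / N := by
    have : 0 < s := by linarith
    positivity
  set L := s * (1 / z.im) ^ (s + 1) / N with hLdef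
  set μ := uniformOn {a | IsRegAdj d N a} with hμ
  set ν : Measure (Fin N → ℝ) := Measure.pi fun _ => gaussianReal 0 1 with hν
  have hP : graphMeasure d N = μ.prod ν := rfl
  set Fh : (Fin N → Fin N → Bool) → (Fin N → ℝ) → ℝ := fun a v =>
    if IsRegAdj d N a then Fm s z (Wgen t (ind a) v) else 0 with hFh
  set h : (Fin N → Fin N → Bool) → ℝ := fun a => ∫ v, Fh a v ∂ν with hh
  have hFm : ∀ a, Measurable (Fh a) := by
    intro a
    by_cases ha : IsRegAdj d N a
    · simp only [hFh, if_pos ha]; exact Fm_meas hs hz t (ind_symm ha)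
    · simp only [hFh, if_neg ha]; exact measurable_const
  have hFb : ∀ a v, |Fh a v| ≤ (1 / (N:ℝ)) * (N * (1 / z.im) ^ s) := by
    intro a v
    by_cases ha : IsRegAdj d N a
    · simp only [hFh, if_pos ha]; exact Fm_abs_le hs hz (Wgen_symm t (ind_symm ha) v)
    · simp only [hFh, if_neg ha, abs_zero]; positivity
  have hFmeas : Measurable (fun ω : (Fin N → Fin N → Bool) × (Fin N → ℝ) => Fh ω.1 ω.2) :=
    measurable_from_prod_countable_right hFm
  have hae : ∀ᵐ ω ∂(μ.prod ν), IsRegAdj d N ω.1 := by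
    have h1 : ∀ᵐ a ∂μ, a ∈ {a | IsRegAdj d N a} := ae_cond_mem (Set.toFinite _).measurableSet
    exact Measure.quasiMeasurePreserving_fst.ae h1
  have haeF : ∀ᵐ ω ∂(μ.prod ν), Ftil t s z ω = Fh ω.1 ω.2 := by
    filter_upwards [hae] with ω hω
    rw [Ftil_eq]; simp only [hFh, if_pos hω]
  have hmean : ∫ ω, Ftil t s z ω ∂(μ.prod ν) = ∫ a, h a ∂μ := by
    rw [integral_congr_ae haeF, integral_prod _ (integrable_of_abs_le hFmeas fun ω => hFb _ _)]
  rw [hP, hmean]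
  set m := ∫ a, h a ∂μ with hm
  have hsub : (μ.prod ν) {ω | u ≤ |Ftil t s z ω - m|} ≤
      (μ.prod ν) ({ω | r1 ≤ |Fh ω.1 ω.2 - h ω.1|} ∪ Prod.fst ⁻¹' {a | r2 ≤ |h a - m|}) := by
    apply measure_mono_ae
    filter_upwards [haeF] with ω hω hmem
    have hmem' : u ≤ |Ftil t s z ω - m| := hmem
    rw [hω] at hmem'
    by_contra hcon
    have hc1 : ¬ (r1 ≤ |Fh ω.1 ω.2 - h ω.1|) := fun hc => hcon (Or.inl hc)
    have hc2 : ¬ (r2 ≤ |h ω.1 - m|) := fun hc => hcon (Or.inr hc)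
    push Not at hc1 hc2
    have := abs_sub_le (Fh ω.1 ω.2) (h ω.1) m
    linarith
  refine hsub.trans ((measure_union_le _ _).trans (add_le_add ?_ ?_))
  · have hmh : Measurable (fun ω : (Fin N → Fin N → Bool) × (Fin N → ℝ) => h ω.1) :=
      (Measurable.of_discrete (f := h)).comp measurable_fst
    have hms : MeasurableSet {ω : (Fin N → Fin N → Bool) × (Fin N → ℝ) |
        r1 ≤ |Fh ω.1 ω.2 - h ω.1|} :=
      measurableSet_le measurable_const (by fun_prop)
    rw [Measure.prod_apply hms]
    calc _ ≤ ∫⁻ _, ENNReal.ofReal (2 * 1 * Real.exp (-r1 ^ 2 / (4 * (N * L ^ 2)))) ∂μ := by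
          apply lintegral_mono
          intro a
          change ν {v | r1 ≤ |Fh a v - h a|} ≤ _
          by_cases ha : IsRegAdj d N a
          · refine tail_of_mgf (hFm a) (hFb a) (by positivity) ?_ hr1.le
            intro l
            have := gaussN N (hFm a) (hFb a) (L := L) (by
              intro x y
              simp only [hFh, if_pos ha]
              exact Fm_lip_v hs hz t (ind_symm ha) x y) l
            refine this.trans (le_of_eq ?_)
            rw [one_mul]; congr 1; ring
          · have h0 : {v | r1 ≤ |Fh a v - h a|} = ∅ := by
              ext v
              simp only [hh, hFh, if_neg ha, integral_zero, sub_zero, abs_zero,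
                Set.mem_setOf_eq, Set.mem_empty_iff_false, iff_false, not_le]
              exact hr1
            rw [h0]; simp
      _ = _ := by simp
  · have hg := graph_tail (h := h) hd hN ha0
      (H := fun M => ∫ v, Fm s z (Wgen t M v) ∂ν) (κ := L * t) (by positivity)
      (fun M M' hM hM' => Fm_mean_lip hs hz ht M M' hM hM')
      (by intro a ha; simp only [hh, hFh, if_pos ha]; rfl) hr2
    refine le_trans (le_of_eq ?_) hg
    rw [← Set.prod_univ, Measure.prod_prod]
    simp
    rfl
theorem stmt2 (E η : ℝ) (hη : 0 < η) (d : ℕ) (hd : 3 ≤ d) :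
    ∃ C : ℝ, 0 < C ∧
      ∀ t : ℝ, 0 < t → ∀ s : ℝ, 1 ≤ s → ∀ u : ℝ, 0 < u →
        ∀ N : ℕ, d + 1 ≤ N → Even (N * d) →
          graphMeasure d N
              {ω | u ≤ |Ftil t s (E + η * Complex.I) ω -
                  ∫ ω', Ftil t s (E + η * Complex.I) ω' ∂(graphMeasure d N)|} ≤
            ENNReal.ofReal
              (2 * Real.exp (-(N * η ^ (2 * s + 2) * u ^ 2) / (8 * s ^ 2)) +
                2 * Real.exp (-(N * η ^ (2 * s + 2) * u ^ 2) / (C * t ^ 2 * s ^ 2))) := by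
  have hd0 : 0 < d := by omega
  have hd0' : (0:ℝ) < d := by exact_mod_cast hd0
  refine ⟨16384 * d * (1 + 2 * (Qc d : ℝ) ^ 2), by positivity, ?_⟩
  intro t ht s hs u hu N hN hev
  have hN0 : 0 < N := by omega
  have hN0' : (0:ℝ) < N := by exact_mod_cast hN0
  have hs0 : 0 < s := by linarith
  set z : ℂ := E + η * Complex.I with hz
  have hzim : z.im = η := by simp [hz]
  by_cases hex : ∃ a0, IsRegAdj d N a0
  · obtain ⟨a0, ha0⟩ := hex
    have hprob := unif_prob ha0
    have hq : 0 < Real.sqrt 2 := by positivity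
    have hq2 : Real.sqrt 2 ^ 2 = 2 := Real.sq_sqrt (by norm_num)
    have hr : u / Real.sqrt 2 + u / 4 ≤ u := by
      have h1 : 4 / 3 ≤ Real.sqrt 2 := Real.le_sqrt_of_sq_le (by norm_num)
      have h2 : u / Real.sqrt 2 ≤ u / (4 / 3) := div_le_div_of_nonneg_left hu.le (by norm_num) h1
      linarith
    have hb := main_bound hd0 hN0 ha0 hs (z := z) (by rw [hzim]; exact hη) ht
      (r1 := u / Real.sqrt 2) (r2 := u / 4) (by positivity) (by positivity) hr
    rw [hzim] at hb
    have hid := rpow_id (s := s) hη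
    set q := (1 / η) ^ (s + 1) with hqdef
    have hqpos : 0 < q := by positivity
    set p := η ^ (2 * s + 2) with hpdef
    have hp : p = 1 / q ^ 2 := by field_simp; linarith
    have e1 : -(u / Real.sqrt 2) ^ 2 / (4 * (N * (s * q / N) ^ 2)) =
        -(N * p * u ^ 2) / (8 * s ^ 2) := by
      rw [div_pow, hq2, hp]; field_simp; norm_num
    have e2 : -(u / 4) ^ 2 / (4 * (4 * (N * d) * (s * q / N * t * 8) ^ 2)) =
        -(N * p * u ^ 2 / (t ^ 2 * s ^ 2)) / (16384 * d) := by
      rw [hp]; field_simp; norm_num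
    have e3 : -(N * p * u ^ 2) / (16384 * d * (1 + 2 * (Qc d : ℝ) ^ 2) * t ^ 2 * s ^ 2) =
        -(N * p * u ^ 2 / (t ^ 2 * s ^ 2)) / (16384 * d * (1 + 2 * (Qc d : ℝ) ^ 2)) := by
      field_simp
    rw [e1, e2, mul_one] at hb
    rw [e3]
    refine absorb (by positivity) (by positivity) (by positivity) ?_ hb
    have : IsProbabilityMeasure (graphMeasure d N) := by
      unfold graphMeasure; infer_instance
    exact prob_le_one
  · have : {a | IsRegAdj d N a} = ∅ := by
      ext a; simp only [Set.mem_setOf_eq, Set.mem_empty_iff_false, iff_false]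
      exact fun h => hex ⟨a, h⟩
    have h0 : graphMeasure d N = 0 := by
      unfold graphMeasure
      rw [this, uniformOn_empty_meas, Measure.zero_prod]
    rw [h0]
    simp
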